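/- Let f : [0, 1) → ℝ be operator convex with f(0) ≤ 0. Then for any positive linear maps φ₁, ..., φₙ on n×n complex matrices with ∑ᵢ φᵢ(1) = 1 and Hermitian matrices x₁, ..., xₙ with spectra in [0, 1): f(∑ᵢ φᵢ(xᵢ)) ≤ ∑ᵢ φᵢ(f(xᵢ)). Moreover, for a general operator convex f on [0,1) (no sign condition at 0), the same inequality holds since the correction terms f(0)(1 − ∑ᵢ φᵢ(1)) vanish. -/

import Mathlib

open Matrix
open scoped ComplexOrder Classical

/-- Functional calculus for (Hermitian) matrices via the spectral theorem. -/
noncomputable def fc {n : ℕ} (f : ℝ → ℝ) (A : Matrix (Fin n) (Fin n) ℂ) :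
    Matrix (Fin n) (Fin n) ℂ :=
  if h : A.IsHermitian then
    (h.eigenvectorUnitary : Matrix (Fin n) (Fin n) ℂ) *
      Matrix.diagonal (fun i => (f (h.eigenvalues i) : ℂ)) *
      (star h.eigenvectorUnitary : Matrix (Fin n) (Fin n) ℂ)
  else 0

/-- The Loewner order: `A ≤ B` iff `B - A` is positive semidefinite. -/
def Loewner {n : ℕ} (A B : Matrix (Fin n) (Fin n) ℂ) : Prop := (B - A).PosSemidef

/-- The operator norm of a matrix acting on Euclidean space. -/
noncomputable def opNorm {n : ℕ} (A : Matrix (Fin n) (Fin n) ℂ) : ℝ :=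
  ‖Matrix.toEuclideanCLM (𝕜 := ℂ) (n := Fin n) A‖

theorem fc_eq_cfc {n : ℕ} (f : ℝ → ℝ) (A : Matrix (Fin n) (Fin n) ℂ) : fc f A = cfc f A := by
  by_cases h : A.IsHermitian
  · rw [fc, dif_pos h, h.cfc_eq, Matrix.IsHermitian.cfc, Unitary.conjStarAlgAut_apply]
    rfl
  · rw [fc, dif_neg h]
    exact (cfc_apply_of_not_predicate (R := ℝ) (p := IsSelfAdjoint) (f := f) A
      (fun h' => h h')).symm

theorem continuousOn_spectrum {n : ℕ} {A : Matrix (Fin n) (Fin n) ℂ} (f : ℝ → ℝ) :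
    ContinuousOn f (spectrum ℝ A) :=
  A.finite_real_spectrum.continuousOn f

theorem fc_isHermitian {n : ℕ} (f : ℝ → ℝ) (A : Matrix (Fin n) (Fin n) ℂ) :
    (fc f A).IsHermitian := by
  rw [fc_eq_cfc]
  exact cfc_predicate f A

/-- Conjugating `fc f A` by the eigenvector matrix of `A` gives a diagonal matrix. -/
theorem conj_fc {n : ℕ} (f : ℝ → ℝ) {A : Matrix (Fin n) (Fin n) ℂ} (h : A.IsHermitian) :
    (h.eigenvectorUnitary : Matrix (Fin n) (Fin n) ℂ)ᴴ * fc f A * h.eigenvectorUnitary =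
      Matrix.diagonal (fun i => (f (h.eigenvalues i) : ℂ)) := by
  have h1 : (h.eigenvectorUnitary : Matrix (Fin n) (Fin n) ℂ)ᴴ * h.eigenvectorUnitary = 1 :=
    Unitary.coe_star_mul_self h.eigenvectorUnitary
  rw [fc, dif_pos h]
  calc _ = ((h.eigenvectorUnitary : Matrix (Fin n) (Fin n) ℂ)ᴴ * h.eigenvectorUnitary) *
        Matrix.diagonal (fun i => (f (h.eigenvalues i) : ℂ)) *
        ((h.eigenvectorUnitary : Matrix (Fin n) (Fin n) ℂ)ᴴ * h.eigenvectorUnitary) := by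
        simp only [Matrix.mul_assoc]; rfl
    _ = _ := by rw [h1]; simp

/-- The quadratic form of the functional calculus. -/
noncomputable def qf {n : ℕ} (f : ℝ → ℝ) (A : Matrix (Fin n) (Fin n) ℂ) (w : Fin n → ℂ) : ℝ :=
  (star w ⬝ᵥ (fc f A *ᵥ w)).re

/-- The weights of the spectral measure of `A` at the vector `w`. -/
noncomputable def spectralWeight {n : ℕ} {A : Matrix (Fin n) (Fin n) ℂ} (h : A.IsHermitian)
    (w : Fin n → ℂ) (i : Fin n) : ℝ :=
  Complex.normSq (((h.eigenvectorUnitary : Matrix (Fin n) (Fin n) ℂ)ᴴ *ᵥ w) i)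

theorem qf_eq_sum {n : ℕ} (f : ℝ → ℝ) {A : Matrix (Fin n) (Fin n) ℂ} (h : A.IsHermitian)
    (w : Fin n → ℂ) : qf f A w = ∑ i, f (h.eigenvalues i) * spectralWeight h w i := by
  set v := (h.eigenvectorUnitary : Matrix (Fin n) (Fin n) ℂ)ᴴ *ᵥ w with hv
  have key : star w ⬝ᵥ (fc f A *ᵥ w) =
      star v ⬝ᵥ (Matrix.diagonal (fun i => (f (h.eigenvalues i) : ℂ)) *ᵥ v) := by
    rw [fc, dif_pos h, hv, Matrix.star_mulVec, Matrix.conjTranspose_conjTranspose,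
      ← Matrix.dotProduct_mulVec, Matrix.mulVec_mulVec, Matrix.mulVec_mulVec]
    rfl
  rw [qf, key, dotProduct, Complex.re_sum]
  refine Finset.sum_congr rfl fun i _ => ?_
  rw [Matrix.mulVec_diagonal, spectralWeight, ← hv, Complex.normSq_apply]
  simp
  ring

theorem loewner_fc_of_qf_le {n : ℕ} (f : ℝ → ℝ) (A : Matrix (Fin n) (Fin n) ℂ)
    {B : Matrix (Fin n) (Fin n) ℂ} (hB : B.IsHermitian)
    (h : ∀ w, qf f A w ≤ (star w ⬝ᵥ (B *ᵥ w)).re) : Loewner (fc f A) B := by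
  have hH : (B - fc f A).IsHermitian := hB.sub (fc_isHermitian f A)
  refine Matrix.PosSemidef.of_dotProduct_mulVec_nonneg hH fun w => ?_
  rw [Complex.nonneg_iff]
  refine ⟨?_, ?_⟩
  · rw [Matrix.sub_mulVec, dotProduct_sub, Complex.sub_re]
    exact sub_nonneg.2 (h w)
  · exact (hH.im_star_dotProduct_mulVec_self w).symm

theorem qf_le_of_loewner {n : ℕ} {f : ℝ → ℝ} {A B : Matrix (Fin n) (Fin n) ℂ}
    (h : Loewner (fc f A) B) (w : Fin n → ℂ) : qf f A w ≤ (star w ⬝ᵥ (B *ᵥ w)).re := by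
  have := (Complex.nonneg_iff.1 (h.dotProduct_mulVec_nonneg w)).1
  rw [Matrix.sub_mulVec, dotProduct_sub, Complex.sub_re] at this
  exact sub_nonneg.1 this

/-- Reduction of the multi-variable Jensen inequality to the positivity of the kernels
`f z - f (l a) - (z - l a) * d (l a) (l b)`, where `d` plays the role of the divided difference. -/
theorem loewner_jensen_of_kernel {n : ℕ} {ι : Type*} [Fintype ι] (f : ℝ → ℝ) (d : ℝ → ℝ → ℝ)
    {X : Matrix (Fin n) (Fin n) ℂ} (hX : X.IsHermitian) (A : ι → Matrix (Fin n) (Fin n) ℂ)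
    (hA : ∀ k, (A k).PosSemidef) (hA1 : ∑ k, A k = 1) (t : ι → ℝ)
    (hXA : X = ∑ k, (t k : ℂ) • A k)
    (hker : ∀ k, (Matrix.of fun a b => ((f (t k) - f (hX.eigenvalues a) -
      (t k - hX.eigenvalues a) * d (hX.eigenvalues a) (hX.eigenvalues b) : ℝ) : ℂ)).PosSemidef) :
    Loewner (fc f X) (∑ k, (f (t k) : ℂ) • A k) := by
  set U : Matrix (Fin n) (Fin n) ℂ := (hX.eigenvectorUnitary : Matrix (Fin n) (Fin n) ℂ) with hU
  have hUU : Uᴴ * U = 1 := Unitary.coe_star_mul_self hX.eigenvectorUnitary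
  have hUU' : U * Uᴴ = 1 := Unitary.coe_mul_star_self hX.eigenvectorUnitary
  have hdiag := conj_fc id hX
  have hfid : fc id X = X := by rw [fc_eq_cfc]; exact cfc_id ℝ X hX
  rw [hfid] at hdiag
  have h1 : ∑ k, Uᴴ * A k * U = 1 := by
    rw [← Finset.sum_mul, ← Finset.mul_sum, hA1, Matrix.mul_one, hUU]
  have h2 : ∑ k, (t k : ℂ) • (Uᴴ * A k * U) =
      Matrix.diagonal (fun i => (hX.eigenvalues i : ℂ)) := by
    calc _ = Uᴴ * (∑ k, (t k : ℂ) • A k) * U := by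
          rw [Finset.mul_sum, Finset.sum_mul]
          simp
      _ = _ := by rw [← hXA]; exact hdiag
  have h3 : Uᴴ * (∑ k, (f (t k) : ℂ) • A k - fc f X) * U =
      ∑ k, (Matrix.of fun a b => ((f (t k) - f (hX.eigenvalues a) -
      (t k - hX.eigenvalues a) * d (hX.eigenvalues a) (hX.eigenvalues b) : ℝ) : ℂ)) ⊙
        (Uᴴ * A k * U) := by
    rw [Matrix.mul_sub, Matrix.sub_mul, conj_fc f hX, Finset.mul_sum, Finset.sum_mul]
    ext a b
    have e1 := congrFun (congrFun h1 a) b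
    have e2 := congrFun (congrFun h2 a) b
    simp only [Matrix.sum_apply, Matrix.smul_apply, smul_eq_mul, Matrix.one_apply,
      Matrix.diagonal_apply] at e1 e2
    simp only [Matrix.sub_apply, Matrix.sum_apply, Matrix.hadamard_apply, Matrix.of_apply,
      Matrix.diagonal_apply, Matrix.mul_smul, Matrix.smul_mul, Matrix.smul_apply, smul_eq_mul]
    have e3 : ∀ k, ((f (t k) - f (hX.eigenvalues a) - (t k - hX.eigenvalues a) *
        d (hX.eigenvalues a) (hX.eigenvalues b) : ℝ) : ℂ) * (Uᴴ * A k * U) a b =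
        f (t k) * (Uᴴ * A k * U) a b - f (hX.eigenvalues a) * (Uᴴ * A k * U) a b
        - d (hX.eigenvalues a) (hX.eigenvalues b) * (t k * (Uᴴ * A k * U) a b)
        + d (hX.eigenvalues a) (hX.eigenvalues b) * hX.eigenvalues a * (Uᴴ * A k * U) a b := by
      intro k; push_cast; ring
    simp only [e3, Finset.sum_add_distrib, Finset.sum_sub_distrib, ← Finset.mul_sum, e1, e2]
    split_ifs with hab
    · ring
    · ring
  have h4 : (Uᴴ * (∑ k, (f (t k) : ℂ) • A k - fc f X) * U).PosSemidef := by
    rw [h3]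
    exact Matrix.posSemidef_sum _ fun k _ => (hker k).hadamard ((hA k).conjTranspose_mul_mul_same U)
  have h5 := h4.mul_mul_conjTranspose_same U
  have h6 : U * (Uᴴ * (∑ k, (f (t k) : ℂ) • A k - fc f X) * U) * Uᴴ =
      ∑ k, (f (t k) : ℂ) • A k - fc f X := by
    calc _ = (U * Uᴴ) * (∑ k, (f (t k) : ℂ) • A k - fc f X) * (U * Uᴴ) := by
          simp only [Matrix.mul_assoc]
      _ = _ := by rw [hUU']; simp
  rw [h6] at h5
  exact h5

/-- The Jensen inequality passes to pointwise limits. -/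
theorem loewner_jensen_of_tendsto {n : ℕ} {ι : Type*} [Fintype ι] (f : ℝ → ℝ) (g : ℕ → ℝ → ℝ)
    {X : Matrix (Fin n) (Fin n) ℂ} (hX : X.IsHermitian) (A : ι → Matrix (Fin n) (Fin n) ℂ)
    (hA : ∀ k, (A k).PosSemidef) (t : ι → ℝ)
    (hg : ∀ᶠ m in Filter.atTop, Loewner (fc (g m) X) (∑ k, (g m (t k) : ℂ) • A k))
    (hlim : ∀ a, Filter.Tendsto (fun m => g m (hX.eigenvalues a)) Filter.atTop
      (nhds (f (hX.eigenvalues a))))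
    (hlim' : ∀ k, Filter.Tendsto (fun m => g m (t k)) Filter.atTop (nhds (f (t k)))) :
    Loewner (fc f X) (∑ k, (f (t k) : ℂ) • A k) := by
  have hre : ∀ (h : ℝ → ℝ) (w : Fin n → ℂ), (star w ⬝ᵥ ((∑ k, (h (t k) : ℂ) • A k) *ᵥ w)).re =
      ∑ k, h (t k) * (star w ⬝ᵥ (A k *ᵥ w)).re := by
    intro h w
    rw [Matrix.sum_mulVec, dotProduct_sum, Complex.re_sum]
    refine Finset.sum_congr rfl fun k _ => ?_
    rw [Matrix.smul_mulVec, dotProduct_smul, smul_eq_mul, Complex.re_ofReal_mul]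
  refine loewner_fc_of_qf_le f X ?_ fun w => ?_
  · refine isSelfAdjoint_sum _ fun k _ => ?_
    exact ((hA k).isHermitian.smul (by simp [IsSelfAdjoint]))
  · rw [hre, qf_eq_sum f hX]
    refine le_of_tendsto_of_tendsto
      (tendsto_finsetSum _ fun i _ => (hlim i).mul_const _)
      (tendsto_finsetSum _ fun k _ => (hlim' k).mul_const _) ?_
    filter_upwards [hg] with m hm
    have := qf_le_of_loewner hm w
    rwa [hre, qf_eq_sum _ hX] at this

theorem exists_zeros_deriv {D : ℝ → ℝ} (hD : Differentiable ℝ D) {J : Set ℝ} (hJ : J.OrdConnected)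
    (Z : Finset ℝ) (hZ : ∀ z ∈ Z, z ∈ J) (h0 : ∀ z ∈ Z, D z = 0) :
    ∃ Z' : Finset ℝ, (∀ z ∈ Z', z ∈ J) ∧ Z.card ≤ Z'.card + 1 ∧ Disjoint Z Z' ∧
      (∀ z ∈ Z', deriv D z = 0) ∧ ∀ z ∈ Z', ∃ y ∈ Z, z < y := by
  induction Z using Finset.induction_on_max with
  | empty => exact ⟨∅, by simp⟩
  | insert a s ha ih =>
    obtain ⟨Z', h1, h2, h3, h4, h5⟩ := ih (fun z hz => hZ z (Finset.mem_insert_of_mem hz))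
      (fun z hz => h0 z (Finset.mem_insert_of_mem hz))
    have has : a ∉ s := fun h => lt_irrefl _ (ha a h)
    rcases s.eq_empty_or_nonempty with rfl | hs
    · exact ⟨∅, by simp⟩
    · set m := s.max' hs with hm
      have hms : m ∈ s := s.max'_mem hs
      have hle : ∀ y ∈ s, y ≤ m := fun y hy => s.le_max' y hy
      obtain ⟨ξ, hξ, hξ0⟩ := exists_deriv_eq_zero (f := D) (ha m hms) hD.continuous.continuousOn
        (by rw [h0 m (Finset.mem_insert_of_mem hms), h0 a (Finset.mem_insert_self _ _)])
      have hξZ : ξ ∉ Z' := by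
        intro h
        obtain ⟨y, hy, hlt⟩ := h5 ξ h
        exact absurd (hle y hy) (not_le.2 (hξ.1.trans hlt))
      refine ⟨insert ξ Z', ?_, ?_, ?_, ?_, ?_⟩
      · intro z hz
        rcases Finset.mem_insert.1 hz with rfl | hz
        · exact hJ.out (hZ m (Finset.mem_insert_of_mem hms)) (hZ a (Finset.mem_insert_self _ _))
            ⟨hξ.1.le, hξ.2.le⟩
        · exact h1 z hz
      · rw [Finset.card_insert_of_notMem has, Finset.card_insert_of_notMem hξZ]
        omega
      · rw [Finset.disjoint_left] at h3 ⊢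
        intro y hy hy'
        rcases Finset.mem_insert.1 hy with rfl | hy <;>
          rcases Finset.mem_insert.1 hy' with rfl | hy'
        · exact lt_irrefl _ hξ.2
        · obtain ⟨y', h, h'⟩ := h5 _ hy'
          exact lt_asymm h' (ha _ h)
        · exact absurd (hle _ hy) (not_le.2 hξ.1)
        · exact h3 hy hy'
      · intro z hz
        rcases Finset.mem_insert.1 hz with rfl | hz
        · exact hξ0
        · exact h4 z hz
      · intro z hz
        rcases Finset.mem_insert.1 hz with rfl | hz
        · exact ⟨a, Finset.mem_insert_self _ _, hξ.2⟩
        · obtain ⟨y, hy, h⟩ := h5 z hz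
          exact ⟨y, Finset.mem_insert_of_mem hy, h⟩

theorem exists_zero_iteratedDeriv {J : Set ℝ} (hJ : J.OrdConnected) (k : ℕ) :
    ∀ {D : ℝ → ℝ}, ContDiff ℝ (⊤ : ℕ∞) D → ∀ Z : Finset ℝ, (∀ z ∈ Z, z ∈ J) →
      (∀ z ∈ Z, D z = 0) → k + 1 ≤ Z.card → ∃ ξ ∈ J, iteratedDeriv k D ξ = 0 := by
  induction k with
  | zero =>
    intro D _ Z hZ h0 hc
    obtain ⟨z, hz⟩ := Finset.card_pos.1 (by omega : 0 < Z.card)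
    exact ⟨z, hZ z hz, by simpa using h0 z hz⟩
  | succ k ih =>
    intro D hD Z hZ h0 hc
    have hd := (contDiff_infty_iff_deriv (f := D)).1 hD
    obtain ⟨Z', h1, h2, -, h4, -⟩ := exists_zeros_deriv hd.1 hJ Z hZ h0
    obtain ⟨ξ, hξ, h⟩ := ih hd.2 Z' h1 h4 (by omega)
    exact ⟨ξ, hξ, by rw [iteratedDeriv_succ', h]⟩

theorem exists_zero_iteratedDeriv_of_double {J : Set ℝ} (hJ : J.OrdConnected) {D : ℝ → ℝ}
    (hD : ContDiff ℝ (⊤ : ℕ∞) D) (S : Finset ℝ) (hS : S.Nonempty) (hSJ : ∀ κ ∈ S, κ ∈ J)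
    (h0 : ∀ κ ∈ S, D κ = 0) (h1 : ∀ κ ∈ S, deriv D κ = 0) {z : ℝ} (hz : z ∈ J) (hzS : z ∉ S)
    (hDz : D z = 0) : ∃ ξ ∈ J, iteratedDeriv (2 * S.card) D ξ = 0 := by
  have hd := (contDiff_infty_iff_deriv (f := D)).1 hD
  obtain ⟨Z', a1, a2, a3, a4, -⟩ := exists_zeros_deriv hd.1 hJ (insert z S)
    (by simpa using ⟨hz, hSJ⟩) (by simpa using ⟨hDz, h0⟩)
  rw [Finset.card_insert_of_notMem hzS] at a2
  have hdisj : Disjoint S Z' := a3.mono_left (Finset.subset_insert _ _)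
  have hpos := hS.card_pos
  obtain ⟨ξ, hξ, h⟩ := exists_zero_iteratedDeriv hJ (2 * S.card - 1) hd.2 (S ∪ Z')
    (fun y hy => (Finset.mem_union.1 hy).elim (hSJ y) (a1 y))
    (fun y hy => (Finset.mem_union.1 hy).elim (h1 y) (a4 y))
    (by rw [Finset.card_union_of_disjoint hdisj]; omega)
  refine ⟨ξ, hξ, ?_⟩
  rw [← h, ← iteratedDeriv_succ']
  congr 1
  omega

theorem contDiff_eval (p : Polynomial ℝ) {k : WithTop ℕ∞} : ContDiff ℝ k fun x => p.eval x := by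
  simpa [Polynomial.coe_aeval_eq_eval] using p.contDiff_aeval (𝕜 := ℝ) k

theorem iteratedDeriv_eval (p : Polynomial ℝ) (k : ℕ) (s : ℝ) :
    iteratedDeriv k (fun x => p.eval x) s = k.factorial * (Polynomial.taylor s p).coeff k := by
  have h : iteratedDeriv k (fun x => p.eval x) = fun x => (Polynomial.derivative^[k] p).eval x := by
    induction k with
    | zero => simp
    | succ k ih =>
      rw [iteratedDeriv_succ, ih]
      funext x
      rw [Polynomial.deriv, Function.iterate_succ_apply']
  rw [h, Polynomial.taylor_coeff, ← Polynomial.factorial_smul_hasseDeriv]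
  simp

theorem iteratedDeriv_sq_eval_mul {g : ℝ → ℝ} (hg : ContDiff ℝ (⊤ : ℕ∞) g) (q : Polynomial ℝ)
    {m : ℕ} (hq : q.natDegree < m) (ξ : ℝ) :
    iteratedDeriv (2 * m) (fun x => (q * q).eval x * g x) ξ = (2 * m).factorial *
      ∑ a ∈ Finset.range m, ∑ b ∈ Finset.range m, (Polynomial.taylor ξ q).coeff a *
        (Polynomial.taylor ξ q).coeff b *
        (iteratedDeriv (2 * m - (a + b)) g ξ / (2 * m - (a + b)).factorial) := by
  set r := Polynomial.taylor ξ q with hr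
  have hrdeg : r.natDegree < m := by rwa [hr, Polynomial.natDegree_taylor]
  have hcoeff : ∀ i, (Polynomial.taylor ξ (q * q)).coeff i =
      ∑ a ∈ Finset.range m, ∑ b ∈ Finset.range m,
        if a + b = i then r.coeff a * r.coeff b else 0 := by
    intro i
    rw [Polynomial.taylor_mul, ← hr]
    conv_lhs => rw [r.as_sum_range' m hrdeg]
    simp only [Finset.sum_mul_sum, Polynomial.finsetSum_coeff, Polynomial.monomial_mul_monomial,
      Polynomial.coeff_monomial]
  have hmul := iteratedDeriv_mul (n := 2 * m) (x := ξ) (f := fun x => (q * q).eval x) (g := g)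
    (contDiff_eval (q * q)).contDiffAt (contDiff_infty.1 hg _).contDiffAt
  have hfun : (fun x => (q * q).eval x * g x) = (fun x => (q * q).eval x) * g := rfl
  rw [hfun, hmul, Finset.mul_sum]
  have hterm : ∀ i ∈ Finset.range (2 * m + 1), ((2 * m).choose i : ℝ) *
      iteratedDeriv i (fun x => (q * q).eval x) ξ * iteratedDeriv (2 * m - i) g ξ =
      ∑ a ∈ Finset.range m, ∑ b ∈ Finset.range m, if a + b = i then (2 * m).factorial *
        (r.coeff a * r.coeff b * (iteratedDeriv (2 * m - i) g ξ / (2 * m - i).factorial))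
        else 0 := by
    intro i hi
    have hi' : i ≤ 2 * m := by simpa [Nat.lt_succ_iff] using hi
    have hch : ((2 * m).choose i : ℝ) * i.factorial =
        (2 * m).factorial / (2 * m - i).factorial := by
      rw [eq_div_iff (by positivity)]
      exact_mod_cast Nat.choose_mul_factorial_mul_factorial hi'
    rw [iteratedDeriv_eval, ← mul_assoc, hch, hcoeff, Finset.mul_sum, Finset.sum_mul]
    refine Finset.sum_congr rfl fun a _ => ?_
    rw [Finset.mul_sum, Finset.sum_mul]
    refine Finset.sum_congr rfl fun b _ => ?_
    split_ifs
    · ring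
    · ring
  rw [Finset.sum_congr rfl hterm, Finset.sum_comm]
  refine Finset.sum_congr rfl fun a ha => ?_
  rw [Finset.sum_comm, Finset.mul_sum]
  refine Finset.sum_congr rfl fun b hb => ?_
  rw [Finset.mem_range] at ha hb
  rw [Finset.sum_ite_eq, if_pos (Finset.mem_range.2 (by omega))]

/-- Positivity of the Hankel form of order `n` of the Taylor coefficients of `g`, from degree two
on, at every point of `J`. -/
def HankelNonneg (n : ℕ) (g : ℝ → ℝ) (J : Set ℝ) : Prop :=
  ∀ t ∈ J, ∀ c : ℕ → ℝ, 0 ≤ ∑ a ∈ Finset.range n, ∑ b ∈ Finset.range n,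
    c a * c b * (iteratedDeriv (a + b + 2) g t / (a + b + 2).factorial)

theorem HankelNonneg.sum_reflect_nonneg {n m : ℕ} {g : ℝ → ℝ} {J : Set ℝ}
    (h : HankelNonneg n g J) (hmn : m ≤ n) {t : ℝ} (ht : t ∈ J) (r : ℕ → ℝ) :
    0 ≤ ∑ a ∈ Finset.range m, ∑ b ∈ Finset.range m,
      r a * r b * (iteratedDeriv (2 * m - (a + b)) g t / (2 * m - (a + b)).factorial) := by
  have h1 := h t ht (fun a => if a < m then r (m - 1 - a) else 0)
  have hsub : Finset.range m ⊆ Finset.range n := Finset.range_mono hmn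
  rw [← Finset.sum_subset hsub ?_] at h1
  · refine h1.trans_eq ?_
    rw [← Finset.sum_range_reflect]
    refine Finset.sum_congr rfl fun a ha => ?_
    rw [← Finset.sum_subset hsub ?_, ← Finset.sum_range_reflect]
    · refine Finset.sum_congr rfl fun b hb => ?_
      rw [Finset.mem_range] at ha hb
      rw [if_pos (by omega), if_pos (by omega)]
      have e1 : m - 1 - (m - 1 - a) = a := by omega
      have e2 : m - 1 - (m - 1 - b) = b := by omega
      have e3 : m - 1 - a + (m - 1 - b) + 2 = 2 * m - (a + b) := by omega
      rw [e1, e2, e3]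
    · intro b _ hb
      rw [Finset.mem_range] at hb
      simp [hb]
  · intro a _ ha
    rw [Finset.mem_range] at ha
    simp [ha]

theorem deriv_mul_eq_zero {a b : ℝ → ℝ} {κ : ℝ} (ha : DifferentiableAt ℝ a κ)
    (hb : DifferentiableAt ℝ b κ) (ha0 : a κ = 0) (hb0 : b κ = 0) :
    HasDerivAt (fun s => a s * b s) 0 κ := by
  simpa [ha0, hb0] using ha.hasDerivAt.fun_mul hb.hasDerivAt

theorem sub_mul_dslope (g : ℝ → ℝ) (a b : ℝ) : (b - a) * dslope g a b = g b - g a :=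
  sub_smul_dslope g a b

theorem kernel_sum_nonneg_of_notMem {n : ℕ} {g : ℝ → ℝ} (hg : ContDiff ℝ (⊤ : ℕ∞) g) {J : Set ℝ}
    (hJ : J.OrdConnected) (hH : HankelNonneg n g J) (S : Finset ℝ) (hS : S.card ≤ n)
    (hSJ : ∀ κ ∈ S, κ ∈ J) {z : ℝ} (hz : z ∈ J) (hzS : z ∉ S) (w : ℝ → ℝ) :
    0 ≤ ∑ x ∈ S, ∑ y ∈ S, w x * w y * (g z - g x - (z - x) * dslope g x y) := by
  rcases S.eq_empty_or_nonempty with rfl | hne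
  · simp
  have hgd : Differentiable ℝ g := hg.differentiable (by simp)
  set m := S.card with hm
  set Q : Polynomial ℝ := ∏ κ ∈ S, (Polynomial.X - Polynomial.C κ) with hQ
  set R : ℝ → Polynomial ℝ := fun x => ∏ κ ∈ S.erase x, (Polynomial.X - Polynomial.C κ) with hR
  set u : ℝ → ℝ := fun x => w x * (z - x) with hu
  set K := ∑ x ∈ S, ∑ y ∈ S, w x * w y * (g z - g x - (z - x) * dslope g x y) with hK
  have hRdeg : ∀ x ∈ S, (R x).natDegree = m - 1 := fun x hx => by
    rw [hR, Polynomial.natDegree_finsetProd_X_sub_C_eq_card, Finset.card_erase_of_mem hx]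
  have hRQ : ∀ x ∈ S, (z - x) * (R x).eval z = Q.eval z := fun x hx => by
    rw [hQ, ← Finset.mul_prod_erase S _ hx]; simp [hR]
  have hRzero : ∀ x ∈ S, ∀ κ ∈ S, κ ≠ x → (R x).eval κ = 0 := fun x hx κ hκ hne => by
    rw [hR, Polynomial.eval_prod]
    exact Finset.prod_eq_zero (Finset.mem_erase.2 ⟨hne, hκ⟩) (by simp)
  have hQzero : ∀ κ ∈ S, Q.eval κ = 0 := fun κ hκ => by
    rw [hQ, Polynomial.eval_prod]
    exact Finset.prod_eq_zero hκ (by simp)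
  set F : ℝ → ℝ → ℝ → ℝ := fun x y s =>
    ((R x).eval s * (R y).eval s) * (g s - g x - (s - x) * dslope g x y) with hF
  set D : ℝ → ℝ := fun s => (∑ x ∈ S, ∑ y ∈ S, u x * u y * F x y s) - K * (Q.eval s * Q.eval s)
    with hD
  have hFz : ∀ x ∈ S, ∀ y ∈ S, ∀ κ ∈ S, F x y κ = 0 ∧ HasDerivAt (F x y) 0 κ := by
    intro x hx y hy κ hκ
    have dR : ∀ x, DifferentiableAt ℝ (fun s => (R x).eval s) κ := fun x => (R x).differentiableAt
    have dl : DifferentiableAt ℝ (fun s => g s - g x - (s - x) * dslope g x y) κ := by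
      have := hgd κ
      fun_prop
    by_cases hx' : κ = x
    · by_cases hy' : κ = y
      · subst hx'; subst hy'
        have h0 : HasDerivAt (fun s => g s - g κ - (s - κ) * dslope g κ κ) 0 κ := by
          have := ((hgd κ).hasDerivAt.sub_const (g κ)).fun_sub
            (((hasDerivAt_id κ).sub_const κ).mul_const (dslope g κ κ))
          simpa [dslope_same] using this
        refine ⟨by simp [hF], ?_⟩
        exact (((dR κ).fun_mul (dR κ)).hasDerivAt.fun_mul h0).congr_deriv (by simp)
      · subst hx'
        refine ⟨by simp [hF], ?_⟩
        exact deriv_mul_eq_zero ((dR κ).mul (dR y)) dl (by simp [hRzero y hy κ hκ hy']) (by simp)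
    · by_cases hy' : κ = y
      · subst hy'
        refine ⟨by simp [hF, sub_mul_dslope], ?_⟩
        exact deriv_mul_eq_zero ((dR x).mul (dR κ)) dl (by simp [hRzero x hx κ hκ hx'])
          (by simp [sub_mul_dslope])
      · refine ⟨by simp [hF, hRzero x hx κ hκ hx'], ?_⟩
        exact ((deriv_mul_eq_zero (dR x) (dR y) (hRzero x hx κ hκ hx')
          (hRzero y hy κ hκ hy')).fun_mul dl.hasDerivAt).congr_deriv
            (by simp [hRzero x hx κ hκ hx'])
  have hD0 : ∀ κ ∈ S, D κ = 0 := fun κ hκ => by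
    simp only [hD, hQzero κ hκ]
    rw [Finset.sum_eq_zero fun x hx => Finset.sum_eq_zero fun y hy => by
      rw [(hFz x hx y hy κ hκ).1, mul_zero]]
    simp
  have hD1 : ∀ κ ∈ S, deriv D κ = 0 := fun κ hκ => by
    have h1 := HasDerivAt.fun_sum (u := S) fun x hx => HasDerivAt.fun_sum (u := S) fun y hy =>
      (hFz x hx y hy κ hκ).2.const_mul (u x * u y)
    have h2 := (deriv_mul_eq_zero (Q.differentiableAt (x := κ)) Q.differentiableAt
      (hQzero κ hκ) (hQzero κ hκ)).const_mul K
    exact (h1.fun_sub h2).deriv.trans (by simp)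
  have hDz : D z = 0 := by
    simp only [hD]
    rw [hK, Finset.sum_mul, ← Finset.sum_sub_distrib]
    refine Finset.sum_eq_zero fun x hx => ?_
    rw [Finset.sum_mul, ← Finset.sum_sub_distrib]
    refine Finset.sum_eq_zero fun y hy => ?_
    simp only [hF, hu]
    linear_combination (w x * w y * (g z - g x - (z - x) * dslope g x y)) *
      ((z - y) * (R y).eval z * hRQ x hx + Q.eval z * hRQ y hy)
  set q : Polynomial ℝ := ∑ x ∈ S, Polynomial.C (u x) * R x with hq
  set P : Polynomial ℝ := ∑ x ∈ S, ∑ y ∈ S, Polynomial.C (u x * u y) * (R x * R y) *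
    (Polynomial.C (g x) + (Polynomial.X - Polynomial.C x) * Polynomial.C (dslope g x y)) with hP
  have hqdeg : q.natDegree < m := by
    have : q.natDegree ≤ m - 1 := Polynomial.natDegree_sum_le_of_forall_le _ _ fun x hx =>
      (Polynomial.natDegree_C_mul_le _ _).trans (hRdeg x hx).le
    have := hne.card_pos
    omega
  have hPdeg : P.natDegree < 2 * m := by
    have : P.natDegree ≤ (m - 1) + (m - 1) + 1 :=
      Polynomial.natDegree_sum_le_of_forall_le _ _ fun x hx =>
      Polynomial.natDegree_sum_le_of_forall_le _ _ fun y hy => by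
        refine Polynomial.natDegree_mul_le.trans (add_le_add ?_ ?_)
        · refine (Polynomial.natDegree_C_mul_le _ _).trans (Polynomial.natDegree_mul_le.trans ?_)
          rw [hRdeg x hx, hRdeg y hy]
        · compute_degree
    have := hne.card_pos
    omega
  have hQmonic : (Q * Q).Monic := (Polynomial.monic_prod_X_sub_C _ _).mul
    (Polynomial.monic_prod_X_sub_C _ _)
  have hQdeg : (Q * Q).natDegree = 2 * m := by
    rw [Polynomial.Monic.natDegree_mul (Polynomial.monic_prod_X_sub_C _ _)
      (Polynomial.monic_prod_X_sub_C _ _), Polynomial.natDegree_finsetProd_X_sub_C_eq_card]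
    omega
  have hDeq : D = fun s => (q * q).eval s * g s - (P + Polynomial.C K * (Q * Q)).eval s := by
    funext s
    simp only [hD, hF, hq, hP, Polynomial.eval_add, Polynomial.eval_mul, Polynomial.eval_finsetSum,
      Polynomial.eval_C, Polynomial.eval_sub, Polynomial.eval_X]
    rw [← sub_sub]
    congr 1
    rw [Finset.sum_mul_sum, Finset.sum_mul, ← Finset.sum_sub_distrib]
    refine Finset.sum_congr rfl fun x _ => ?_
    rw [Finset.sum_mul, ← Finset.sum_sub_distrib]
    refine Finset.sum_congr rfl fun y _ => ?_
    ring
  have hsm1 : ContDiff ℝ (⊤ : ℕ∞) fun s => (q * q).eval s * g s := (contDiff_eval _).mul hg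
  have hsm2 : ContDiff ℝ (⊤ : ℕ∞) fun s => (P + Polynomial.C K * (Q * Q)).eval s := contDiff_eval _
  obtain ⟨ξ, hξ, hξ0⟩ := exists_zero_iteratedDeriv_of_double hJ (D := D)
    (by rw [hDeq]; exact hsm1.sub hsm2) S hne hSJ hD0 hD1 hz hzS hDz
  have hcoeff : (Polynomial.taylor ξ (P + Polynomial.C K * (Q * Q))).coeff (2 * m) = K := by
    have e1 : (Polynomial.taylor ξ P).coeff (2 * m) = 0 :=
      Polynomial.coeff_eq_zero_of_natDegree_lt (by rwa [Polynomial.natDegree_taylor])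
    have e2 : (Polynomial.taylor ξ (Q * Q)).coeff (2 * m) = 1 := by
      have := Polynomial.leadingCoeff_taylor (r := ξ) (f := Q * Q)
      rw [hQmonic.leadingCoeff, Polynomial.leadingCoeff, Polynomial.natDegree_taylor, hQdeg] at this
      exact this
    rw [map_add, Polynomial.coeff_add, e1, Polynomial.taylor_mul, Polynomial.taylor_C,
      Polynomial.coeff_C_mul, e2]
    ring
  rw [hDeq, iteratedDeriv_fun_sub (contDiff_infty.1 hsm1 _).contDiffAt
    (contDiff_infty.1 hsm2 _).contDiffAt, iteratedDeriv_sq_eval_mul hg q hqdeg, iteratedDeriv_eval,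
    hcoeff, ← mul_sub] at hξ0
  have hpos : ((2 * m).factorial : ℝ) ≠ 0 := by positivity
  rw [← sub_eq_zero.1 ((mul_eq_zero.1 hξ0).resolve_left hpos)]
  exact hH.sum_reflect_nonneg hS hξ _

theorem posSemidef_of_real {n : ℕ} (K : Fin n → Fin n → ℝ) (hK : ∀ a b, K a b = K b a)
    (h : ∀ w : Fin n → ℝ, 0 ≤ ∑ a, ∑ b, w a * w b * K a b) :
    (Matrix.of fun a b => (K a b : ℂ)).PosSemidef := by
  have hH : (Matrix.of fun a b => (K a b : ℂ)).IsHermitian := by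
    ext a b
    simp [Matrix.conjTranspose_apply, hK a b]
  refine Matrix.PosSemidef.of_dotProduct_mulVec_nonneg hH fun v => ?_
  rw [Complex.nonneg_iff]
  refine ⟨?_, (hH.im_star_dotProduct_mulVec_self v).symm⟩
  have : (star v ⬝ᵥ ((Matrix.of fun a b => (K a b : ℂ)) *ᵥ v)).re =
      (∑ a, ∑ b, (v a).re * (v b).re * K a b) + ∑ a, ∑ b, (v a).im * (v b).im * K a b := by
    simp only [dotProduct, Matrix.mulVec, Finset.mul_sum, Complex.re_sum, Matrix.of_apply,
      ← Finset.sum_add_distrib]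
    refine Finset.sum_congr rfl fun a _ => Finset.sum_congr rfl fun b _ => ?_
    simp
    ring
  rw [this]
  exact add_nonneg (h _) (h _)

theorem kernel_sum_nonneg {n : ℕ} {g : ℝ → ℝ} (hg : ContDiff ℝ (⊤ : ℕ∞) g) {J : Set ℝ}
    (hJ : J.OrdConnected) (hH : HankelNonneg n g J) (S : Finset ℝ) (hS : S.card ≤ n)
    (hSJ : ∀ κ ∈ S, κ ∈ J) {z : ℝ} (hz : z ∈ J) (w : ℝ → ℝ) :
    0 ≤ ∑ x ∈ S, ∑ y ∈ S, w x * w y * (g z - g x - (z - x) * dslope g x y) := by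
  have h := kernel_sum_nonneg_of_notMem hg hJ hH (S.erase z)
    ((Finset.card_le_card (Finset.erase_subset _ _)).trans hS)
    (fun κ hκ => hSJ κ (Finset.mem_of_mem_erase hκ)) hz (Finset.notMem_erase z S) w
  rw [← Finset.sum_subset (Finset.erase_subset z S) ?_]
  · refine h.trans_eq (Finset.sum_congr rfl fun x _ => ?_)
    refine Finset.sum_subset (Finset.erase_subset z S) fun y hy hy' => ?_
    have : y = z := by simpa [hy] using hy'
    subst this
    simp [sub_mul_dslope]
  · intro x hx hx'
    have : x = z := by simpa [hx] using hx'
    subst this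
    simp

theorem kernel_symm (g : ℝ → ℝ) (x y z : ℝ) :
    g z - g x - (z - x) * dslope g x y = g z - g y - (z - y) * dslope g y x := by
  have h1 := sub_mul_dslope g x y
  have h2 : dslope g y x = dslope g x y := by
    by_cases h : x = y
    · rw [h]
    · rw [dslope_of_ne _ h, dslope_of_ne _ (Ne.symm h), slope_comm]
  rw [h2]
  linear_combination -h1

/-- Hankel positivity of order `n` makes the Jensen kernel positive at any `n` nodes. -/
theorem kernel_posSemidef {n : ℕ} {g : ℝ → ℝ} (hg : ContDiff ℝ (⊤ : ℕ∞) g) {J : Set ℝ}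
    (hJ : J.OrdConnected) (hH : HankelNonneg n g J) {l : Fin n → ℝ} (hl : ∀ a, l a ∈ J)
    {z : ℝ} (hz : z ∈ J) : (Matrix.of fun a b =>
      ((g z - g (l a) - (z - l a) * dslope g (l a) (l b) : ℝ) : ℂ)).PosSemidef := by
  refine posSemidef_of_real _ (fun a b => kernel_symm g _ _ _) fun w => ?_
  have hS := kernel_sum_nonneg hg hJ hH (Finset.univ.image l)
    (Finset.card_image_le.trans (by simp)) (by simpa using hl) hz
    (fun x => ∑ a with l a = x, w a)
  refine hS.trans_eq ?_
  have key : ∀ h : ℝ → ℝ, ∑ x ∈ Finset.univ.image l, (∑ a with l a = x, w a) * h x =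
      ∑ a, w a * h (l a) := by
    intro h
    rw [← Finset.sum_fiberwise_of_maps_to (s := Finset.univ) (t := Finset.univ.image l) (g := l)
      (fun a _ => Finset.mem_image_of_mem l (Finset.mem_univ a))]
    refine Finset.sum_congr rfl fun x _ => ?_
    rw [Finset.sum_mul]
    refine Finset.sum_congr rfl fun a ha => ?_
    rw [(Finset.mem_filter.1 ha).2]
  simp only [mul_assoc, ← Finset.mul_sum]
  rw [key (fun x => ∑ y ∈ Finset.univ.image l, (∑ a with l a = y, w a) *
    (g z - g x - (z - x) * dslope g x y))]
  refine Finset.sum_congr rfl fun a _ => ?_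
  rw [key (fun y => g z - g (l a) - (z - l a) * dslope g (l a) y)]

section FunctionalCalculus

variable {n : ℕ} {M : Matrix (Fin n) (Fin n) ℂ}

theorem fc_comp (hM : M.IsHermitian) (g h : ℝ → ℝ) : fc g (fc h M) = fc (fun s => g (h s)) M := by
  rw [fc_eq_cfc, fc_eq_cfc, fc_eq_cfc]
  exact (cfc_comp g h M hM ((M.finite_real_spectrum.image h).continuousOn g)
    (continuousOn_spectrum h)).symm

theorem qf_comp (hM : M.IsHermitian) (g h : ℝ → ℝ) (w : Fin n → ℂ) :
    qf g (fc h M) w = qf (fun s => g (h s)) M w := by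
  rw [qf, fc_comp hM, qf]

theorem spectrum_fc (hM : M.IsHermitian) (h : ℝ → ℝ) :
    spectrum ℝ (fc h M) = h '' spectrum ℝ M := by
  rw [fc_eq_cfc]
  exact cfc_map_spectrum h M hM (continuousOn_spectrum h)

theorem fc_affine (hM : M.IsHermitian) (t ε : ℝ) :
    fc (fun s => t + ε * s) M = algebraMap ℝ _ t + ε • M := by
  rw [fc_eq_cfc]
  exact (cfc_const_add t (fun s => ε * s) M (continuousOn_spectrum _) hM).trans
    (congrArg _ (cfc_const_mul_id ε M hM))

theorem qf_mul_pow (hM : M.IsHermitian) (ε : ℝ) (k : ℕ) (w : Fin n → ℂ) :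
    qf (fun s => (ε * s) ^ k) M w = (star w ⬝ᵥ ((ε • M) ^ k *ᵥ w)).re := by
  have h : fc (fun s => (ε * s) ^ k) M = (ε • M) ^ k := by
    rw [fc_eq_cfc]
    exact (cfc_pow (fun s => ε * s) k M (continuousOn_spectrum _) hM).trans
      (congrArg (· ^ k) (cfc_const_mul_id ε M hM))
  rw [qf, h]

theorem continuous_spectralWeight (hM : M.IsHermitian) {w : ℝ → Fin n → ℂ} (hw : Continuous w)
    (i : Fin n) : Continuous fun ε => spectralWeight hM (w ε) i := by
  unfold spectralWeight
  have : Continuous fun ε => (hM.eigenvectorUnitary : Matrix (Fin n) (Fin n) ℂ)ᴴ *ᵥ w ε :=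
    continuous_const.matrix_mulVec hw
  exact Complex.continuous_normSq.comp (continuous_pi_iff.1 this i)

theorem eventually_spectrum_subset (hM : M.IsHermitian) {J : Set ℝ} (hJ : IsOpen J) {t : ℝ}
    (ht : t ∈ J) : ∀ᶠ ε in nhdsWithin (0 : ℝ) (Set.Ioi 0),
      spectrum ℝ (fc (fun s => t + ε * s) M) ⊆ J := by
  refine eventually_nhdsWithin_of_eventually_nhds ?_
  have : ∀ᶠ ε in nhds (0 : ℝ), ∀ s ∈ spectrum ℝ M, t + ε * s ∈ J := by
    rw [Filter.eventually_all_finite M.finite_real_spectrum]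
    intro s _
    have hc : ContinuousAt (fun ε : ℝ => t + ε * s) 0 := by fun_prop
    exact hc.eventually_mem (hJ.mem_nhds (by simpa using ht))
  filter_upwards [this] with ε hε
  rw [spectrum_fc hM]
  rintro _ ⟨s, hs, rfl⟩
  exact hε s hs

theorem tendsto_qf_taylor (hM : M.IsHermitian) {g : ℝ → ℝ} (hg : ContDiff ℝ (⊤ : ℕ∞) g) (t : ℝ)
    (K : ℕ) {w : ℝ → Fin n → ℂ} (hw : Continuous w) :
    Filter.Tendsto (fun ε => (qf g (fc (fun s => t + ε * s) M) (w ε) -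
      ∑ k ∈ Finset.range (K + 1), iteratedDeriv k g t / k.factorial *
        (star (w ε) ⬝ᵥ ((ε • M) ^ k *ᵥ w ε)).re) / ε ^ K)
      (nhdsWithin (0 : ℝ) (Set.Ioi 0)) (nhds 0) := by
  set R : ℝ → ℝ := fun x => g x - ∑ k ∈ Finset.range (K + 1),
    iteratedDeriv k g t / k.factorial * (x - t) ^ k with hR
  have hRo : R =o[nhds t] fun x => (x - t) ^ K := by
    have := taylor_isLittleO_univ (x₀ := t) (contDiff_infty.1 hg K)
    refine this.congr_left fun x => ?_
    rw [taylor_within_apply, hR]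
    congr 1
    refine Finset.sum_congr rfl fun k _ => ?_
    rw [iteratedDerivWithin_univ, smul_eq_mul]
    ring
  have key : ∀ ε, qf g (fc (fun s => t + ε * s) M) (w ε) -
      ∑ k ∈ Finset.range (K + 1), iteratedDeriv k g t / k.factorial *
        (star (w ε) ⬝ᵥ ((ε • M) ^ k *ᵥ w ε)).re =
      ∑ i, R (t + ε * hM.eigenvalues i) * spectralWeight hM (w ε) i := by
    intro ε
    simp only [qf_comp hM, ← qf_mul_pow hM, qf_eq_sum _ hM, Finset.mul_sum]
    rw [Finset.sum_comm, ← Finset.sum_sub_distrib]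
    refine Finset.sum_congr rfl fun i _ => ?_
    simp only [hR]
    rw [sub_mul, Finset.sum_mul]
    congr 1
    refine Finset.sum_congr rfl fun k _ => ?_
    ring
  simp only [key, Finset.sum_div]
  rw [show nhds (0 : ℝ) = nhds (∑ _i : Fin n, 0) by simp]
  refine tendsto_finsetSum _ fun i _ => ?_
  set l := hM.eigenvalues i
  have h1 : Filter.Tendsto (fun ε : ℝ => t + ε * l) (nhds 0) (nhds t) := by
    have hc : ContinuousAt (fun ε : ℝ => t + ε * l) 0 := by fun_prop
    simpa [ContinuousAt] using hc
  have h2 : (fun ε => R (t + ε * l)) =o[nhds 0] fun ε : ℝ => ε ^ K := by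
    refine (hRo.comp_tendsto h1).trans_isBigO ?_
    refine Asymptotics.IsBigO.of_bound (|l| ^ K) (Filter.Eventually.of_forall fun ε => ?_)
    simp [mul_pow, mul_comm]
  have h3 := h2.tendsto_div_nhds_zero.mul
    (continuous_spectralWeight hM hw i).continuousAt.tendsto
  rw [zero_mul] at h3
  refine (h3.mono_left nhdsWithin_le_nhds).congr fun ε => ?_
  ring

end FunctionalCalculus

/-- Midpoint convexity of the functional calculus of order `n` on `J`. -/
def MidConvex (n : ℕ) (g : ℝ → ℝ) (J : Set ℝ) : Prop :=
  ∀ A B : Matrix (Fin n) (Fin n) ℂ, A.IsHermitian → B.IsHermitian → spectrum ℝ A ⊆ J →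
    spectrum ℝ B ⊆ J → spectrum ℝ ((1 / 2 : ℝ) • (A + B)) ⊆ J → ∀ w,
    qf g ((1 / 2 : ℝ) • (A + B)) w ≤ (qf g A w + qf g B w) / 2

theorem add_pow_eq_left {R : Type*} [Ring R] (X H : R) (k : ℕ) :
    (X + H) ^ k = X ^ k + ∑ i ∈ Finset.range k, X ^ i * H * (X + H) ^ (k - 1 - i) := by
  induction k with
  | zero => simp
  | succ k ih =>
    rw [Finset.sum_range_succ']
    have h1 : ∀ i, k + 1 - 1 - (i + 1) = k - 1 - i := by intro i; omega
    simp only [h1, pow_succ' X]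
    calc (X + H) ^ (k + 1) = X * (X + H) ^ k + H * (X + H) ^ k := by rw [pow_succ', add_mul]
      _ = _ := by
        nth_rewrite 1 [ih]
        rw [mul_add, Finset.mul_sum]
        simp [mul_assoc, add_assoc]

theorem add_pow_eq_right {R : Type*} [Ring R] (X H : R) (k : ℕ) :
    (X + H) ^ k = X ^ k + ∑ i ∈ Finset.range k, (X + H) ^ (k - 1 - i) * H * X ^ i := by
  induction k with
  | zero => simp
  | succ k ih =>
    rw [Finset.sum_range_succ']
    have h1 : ∀ i, k + 1 - 1 - (i + 1) = k - 1 - i := by intro i; omega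
    simp only [h1, pow_succ X]
    calc (X + H) ^ (k + 1) = (X + H) ^ k * X + (X + H) ^ k * H := by rw [pow_succ, mul_add]
      _ = _ := by
        nth_rewrite 1 [ih]
        rw [add_mul, Finset.sum_mul]
        simp [mul_assoc, add_assoc]

theorem add_pow_eq_second_order {R : Type*} [Ring R] (X H : R) (k : ℕ) :
    (X + H) ^ k = X ^ k + ∑ i ∈ Finset.range k, X ^ i * H * X ^ (k - 1 - i) +
      ∑ i ∈ Finset.range k, ∑ l ∈ Finset.range (k - 1 - i),
        X ^ i * H * (X + H) ^ (k - 1 - i - 1 - l) * H * X ^ l := by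
  rw [add_pow_eq_left, add_assoc, ← Finset.sum_add_distrib]
  congr 1
  refine Finset.sum_congr rfl fun i _ => ?_
  rw [add_pow_eq_right X H (k - 1 - i), mul_add, Finset.mul_sum]
  simp only [mul_assoc]

theorem add_pow_add_sub_pow {R : Type*} [Ring R] (X H : R) (k : ℕ) :
    (X + H) ^ k + (X - H) ^ k = 2 * X ^ k +
      ∑ i ∈ Finset.range k, ∑ l ∈ Finset.range (k - 1 - i),
        X ^ i * H * ((X + H) ^ (k - 1 - i - 1 - l) + (X - H) ^ (k - 1 - i - 1 - l)) *
          H * X ^ l := by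
  have h := add_pow_eq_second_order X (-H) k
  rw [← sub_eq_add_neg] at h
  rw [add_pow_eq_second_order X H k, h]
  simp only [mul_neg, neg_mul, neg_neg, mul_add, add_mul, Finset.sum_add_distrib,
    Finset.sum_neg_distrib, two_mul]
  abel

section Tridiagonal

variable {n : ℕ}

/-- The lower shift matrix. -/
def shiftMatrix (n : ℕ) : Matrix (Fin n) (Fin n) ℂ :=
  Matrix.of fun i j => if (i : ℕ) = j + 1 then 1 else 0

/-- The symmetric matrix with ones next to the diagonal. -/
def jacobiMatrix (n : ℕ) : Matrix (Fin n) (Fin n) ℂ := shiftMatrix n + (shiftMatrix n)ᵀ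

/-- The first basis vector. -/
def firstVec (n : ℕ) : Fin n → ℂ := fun i => if (i : ℕ) = 0 then 1 else 0

/-- The projection onto the first coordinate. -/
def firstProj (n : ℕ) : Matrix (Fin n) (Fin n) ℂ := Matrix.vecMulVec (firstVec n) (firstVec n)

/-- The conjugate of `ε • jacobiMatrix n` by `diag(1, ε, ε ^ 2, …)`. -/
noncomputable def scaledShift (n : ℕ) (ε : ℝ) : Matrix (Fin n) (Fin n) ℂ :=
  shiftMatrix n + ((ε : ℂ) ^ 2) • (shiftMatrix n)ᵀ

/-- The test vector with entries `c k * ε ^ (n - 1 - k)`. -/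
noncomputable def testVec (n : ℕ) (c : ℕ → ℝ) (ε : ℝ) : Fin n → ℂ :=
  fun k => c k * (ε : ℂ) ^ (n - 1 - (k : ℕ))

/-- The moments of `scaledShift`. -/
noncomputable def shiftMoment (n : ℕ) (c : ℕ → ℝ) (i : ℕ) (ε : ℝ) : ℂ :=
  (fun k : Fin n => (c k : ℂ)) ⬝ᵥ (scaledShift n ε ^ i *ᵥ firstVec n)

theorem jacobiMatrix_transpose : (jacobiMatrix n)ᵀ = jacobiMatrix n := by
  rw [jacobiMatrix, Matrix.transpose_add, Matrix.transpose_transpose, add_comm]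

theorem jacobiMatrix_isHermitian : (jacobiMatrix n).IsHermitian := by
  ext i j
  simp only [jacobiMatrix, shiftMatrix, Matrix.conjTranspose_apply, Matrix.add_apply,
    Matrix.transpose_apply, Matrix.of_apply]
  split_ifs <;> simp

theorem firstProj_isHermitian : (firstProj n).IsHermitian := by
  ext i j
  simp only [firstProj, firstVec, Matrix.conjTranspose_apply, Matrix.vecMulVec_apply]
  split_ifs <;> simp

theorem star_testVec (c : ℕ → ℝ) (ε : ℝ) : star (testVec n c ε) = testVec n c ε := by
  ext k
  simp [testVec]

theorem continuous_testVec (c : ℕ → ℝ) : Continuous (testVec n c) := by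
  unfold testVec
  fun_prop

theorem continuous_scaledShift : Continuous (scaledShift n) := by
  unfold scaledShift
  fun_prop

theorem continuous_shiftMoment (c : ℕ → ℝ) (i : ℕ) : Continuous (shiftMoment n c i) := by
  unfold shiftMoment
  exact continuous_const.dotProduct ((continuous_scaledShift.pow i).matrix_mulVec continuous_const)

theorem shiftMatrix_pow_mulVec (i : ℕ) (j : Fin n) :
    (shiftMatrix n ^ i *ᵥ firstVec n) j = if (j : ℕ) = i then 1 else 0 := by
  induction i generalizing j with
  | zero => simp [firstVec]
  | succ i ih =>
    rw [pow_succ', ← Matrix.mulVec_mulVec, Matrix.mulVec, dotProduct]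
    simp only [ih]
    simp only [shiftMatrix, Matrix.of_apply]
    by_cases hi : i < n
    · rw [Finset.sum_eq_single (⟨i, hi⟩ : Fin n)]
      · simp
      · intro b _ hb
        have : (b : ℕ) ≠ i := fun h => hb (Fin.ext h)
        simp [this]
      · simp
    · have h1 : (j : ℕ) ≠ i + 1 := by omega
      rw [if_neg h1]
      refine Finset.sum_eq_zero fun b _ => ?_
      have : (b : ℕ) ≠ i := by omega
      simp [this]

theorem shiftMoment_zero (c : ℕ → ℝ) (i : ℕ) :
    shiftMoment n c i 0 = if i < n then (c i : ℂ) else 0 := by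
  have : scaledShift n 0 = shiftMatrix n := by simp [scaledShift]
  rw [shiftMoment, this, dotProduct]
  simp only [shiftMatrix_pow_mulVec]
  split_ifs with hi
  · rw [Finset.sum_eq_single (⟨i, hi⟩ : Fin n)]
    · simp
    · intro b _ hb
      have : (b : ℕ) ≠ i := fun h => hb (Fin.ext h)
      simp [this]
    · simp
  · refine Finset.sum_eq_zero fun b _ => ?_
    have : (b : ℕ) ≠ i := by omega
    simp [this]

theorem diagonal_mul_scaledShift_pow (ε : ℝ) (i : ℕ) :
    Matrix.diagonal (fun k : Fin n => (ε : ℂ) ^ (k : ℕ)) * scaledShift n ε ^ i =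
      ((ε : ℂ) • jacobiMatrix n) ^ i * Matrix.diagonal (fun k : Fin n => (ε : ℂ) ^ (k : ℕ)) := by
  have h : SemiconjBy (Matrix.diagonal (fun k : Fin n => (ε : ℂ) ^ (k : ℕ))) (scaledShift n ε)
      ((ε : ℂ) • jacobiMatrix n) := by
    ext i j
    simp only [Matrix.diagonal_mul, Matrix.mul_diagonal, scaledShift, jacobiMatrix, shiftMatrix,
      Matrix.add_apply, Matrix.smul_apply, Matrix.transpose_apply, Matrix.of_apply, smul_eq_mul]
    split_ifs with h1 h2 h2
    · omega
    · rw [h1]; ring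
    · rw [h2]; ring
    · ring
  exact h.pow_right i

theorem testVec_dotProduct_pow (c : ℕ → ℝ) (ε : ℝ) (i : ℕ) :
    testVec n c ε ⬝ᵥ (((ε : ℂ) • jacobiMatrix n) ^ i *ᵥ firstVec n) =
      (ε : ℂ) ^ (n - 1) * shiftMoment n c i ε := by
  have h1 : Matrix.diagonal (fun k : Fin n => (ε : ℂ) ^ (k : ℕ)) *ᵥ firstVec n = firstVec n := by
    ext k
    rw [Matrix.mulVec_diagonal, firstVec]
    split_ifs with h
    · simp [h]
    · simp
  conv_lhs =>
    rw [← h1, Matrix.mulVec_mulVec, ← diagonal_mul_scaledShift_pow, ← Matrix.mulVec_mulVec]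
  rw [shiftMoment, dotProduct, dotProduct, Finset.mul_sum]
  refine Finset.sum_congr rfl fun k _ => ?_
  rw [Matrix.mulVec_diagonal, testVec]
  have : (ε : ℂ) ^ (n - 1) = (ε : ℂ) ^ (n - 1 - (k : ℕ)) * (ε : ℂ) ^ (k : ℕ) := by
    rw [← pow_add]
    congr 1
    omega
  rw [this]
  ring

theorem dotProduct_firstProj_mulVec (A B : Matrix (Fin n) (Fin n) ℂ) (u v : Fin n → ℂ) :
    u ⬝ᵥ ((A * firstProj n * B) *ᵥ v) = (u ⬝ᵥ (A *ᵥ firstVec n)) * (firstVec n ⬝ᵥ (B *ᵥ v)) := by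
  rw [← Matrix.mulVec_mulVec, ← Matrix.mulVec_mulVec, firstProj, Matrix.vecMulVec_mulVec,
    Matrix.mulVec_smul, dotProduct_smul]
  simp

/-- The rescaled second difference of the `k`-th moment. -/
noncomputable def momentDiff (n : ℕ) (c : ℕ → ℝ) (k : ℕ) (ε : ℝ) : ℂ :=
  ∑ i ∈ Finset.range k, ∑ l ∈ Finset.range (k - 1 - i),
    shiftMoment n c i ε * shiftMoment n c l ε * (firstVec n ⬝ᵥ
      ((((ε : ℂ) • jacobiMatrix n + (ε : ℂ) • firstProj n) ^ (k - 1 - i - 1 - l) +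
        ((ε : ℂ) • jacobiMatrix n - (ε : ℂ) • firstProj n) ^ (k - 1 - i - 1 - l)) *ᵥ firstVec n))

theorem moment_second_difference (hn : 0 < n) (c : ℕ → ℝ) (k : ℕ) (ε : ℝ) :
    testVec n c ε ⬝ᵥ ((((ε : ℂ) • jacobiMatrix n + (ε : ℂ) • firstProj n) ^ k +
        ((ε : ℂ) • jacobiMatrix n - (ε : ℂ) • firstProj n) ^ k) *ᵥ testVec n c ε) =
      2 * (testVec n c ε ⬝ᵥ (((ε : ℂ) • jacobiMatrix n) ^ k *ᵥ testVec n c ε)) +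
        (ε : ℂ) ^ (2 * n) * momentDiff n c k ε := by
  set X := (ε : ℂ) • jacobiMatrix n with hX
  have hXt : ∀ l, firstVec n ⬝ᵥ (X ^ l *ᵥ testVec n c ε) =
      testVec n c ε ⬝ᵥ (X ^ l *ᵥ firstVec n) := fun l => by
    have : (X ^ l)ᵀ = X ^ l := by
      rw [Matrix.transpose_pow, hX, Matrix.transpose_smul, jacobiMatrix_transpose]
    rw [Matrix.dotProduct_mulVec, ← Matrix.mulVec_transpose, this, dotProduct_comm]
  rw [add_pow_add_sub_pow, Matrix.add_mulVec, dotProduct_add, two_mul, Matrix.add_mulVec,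
    dotProduct_add, two_mul, Matrix.sum_mulVec, dotProduct_sum, momentDiff, Finset.mul_sum]
  congr 1
  refine Finset.sum_congr rfl fun i _ => ?_
  rw [Matrix.sum_mulVec, dotProduct_sum, Finset.mul_sum]
  refine Finset.sum_congr rfl fun l _ => ?_
  set P := (X + (ε : ℂ) • firstProj n) ^ (k - 1 - i - 1 - l) +
    (X - (ε : ℂ) • firstProj n) ^ (k - 1 - i - 1 - l)
  have e1 : X ^ i * (ε : ℂ) • firstProj n * P * (ε : ℂ) • firstProj n * X ^ l =
      ((ε : ℂ) ^ 2) • (X ^ i * firstProj n * (P * firstProj n * X ^ l)) := by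
    simp only [Matrix.mul_smul, Matrix.smul_mul, smul_smul, Matrix.mul_assoc, pow_two]
  have e2 : (ε : ℂ) ^ (2 * n) = (ε : ℂ) ^ 2 * ((ε : ℂ) ^ (n - 1) * (ε : ℂ) ^ (n - 1)) := by
    rw [← pow_add, ← pow_add]
    congr 1
    omega
  rw [e1, Matrix.smul_mulVec, dotProduct_smul, dotProduct_firstProj_mulVec,
    dotProduct_firstProj_mulVec, hXt, testVec_dotProduct_pow, testVec_dotProduct_pow, e2,
    smul_eq_mul]
  ring

theorem continuous_momentDiff (c : ℕ → ℝ) (k : ℕ) : Continuous (momentDiff n c k) := by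
  unfold momentDiff
  refine continuous_finsetSum _ fun i _ => continuous_finsetSum _ fun l _ => ?_
  refine ((continuous_shiftMoment c i).mul (continuous_shiftMoment c l)).mul ?_
  refine continuous_const.dotProduct (Continuous.matrix_mulVec ?_ continuous_const)
  have h1 : Continuous fun ε : ℝ => (ε : ℂ) • jacobiMatrix n :=
    Complex.continuous_ofReal.smul continuous_const
  have h2 : Continuous fun ε : ℝ => (ε : ℂ) • firstProj n :=
    Complex.continuous_ofReal.smul continuous_const
  exact ((h1.add h2).pow _).add ((h1.sub h2).pow _)

theorem momentDiff_zero (hn : 0 < n) (c : ℕ → ℝ) (k : ℕ) :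
    momentDiff n c k 0 = 2 * ∑ i ∈ Finset.range n, ∑ l ∈ Finset.range n,
      if i + l + 2 = k then (c i * c l : ℂ) else 0 := by
  have hv : firstVec n ⬝ᵥ firstVec n = 1 := by
    rw [dotProduct, Finset.sum_eq_single (⟨0, hn⟩ : Fin n)]
    · simp [firstVec]
    · intro b _ hb
      have : (b : ℕ) ≠ 0 := fun h => hb (Fin.ext h)
      simp [firstVec, this]
    · simp
  set K := n + k
  set F : ℕ → ℕ → ℂ := fun i l => if i + l + 2 = k then
    2 * ((if i < n then (c i : ℂ) else 0) * (if l < n then (c l : ℂ) else 0)) else 0 with hF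
  have h1 : momentDiff n c k 0 = ∑ i ∈ Finset.range K, ∑ l ∈ Finset.range K, F i l := by
    rw [momentDiff, ← Finset.sum_subset (Finset.range_mono (show k ≤ K by omega))]
    · refine Finset.sum_congr rfl fun i hi => ?_
      rw [← Finset.sum_subset (Finset.range_mono (show k - 1 - i ≤ K by omega))]
      · refine Finset.sum_congr rfl fun l hl => ?_
        rw [Finset.mem_range] at hi hl
        simp only [shiftMoment_zero, Complex.ofReal_zero, zero_smul, add_zero, sub_zero, hF]
        by_cases h : i + l + 2 = k
        · have : k - 1 - i - 1 - l = 0 := by omega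
          rw [if_pos h, this, pow_zero, Matrix.add_mulVec, Matrix.one_mulVec, dotProduct_add, hv]
          ring
        · have : k - 1 - i - 1 - l ≠ 0 := by omega
          rw [if_neg h, zero_pow this]
          simp
      · intro l _ hl
        rw [Finset.mem_range] at hl
        exact if_neg (by omega)
    · intro i _ hi
      rw [Finset.mem_range] at hi
      exact Finset.sum_eq_zero fun l _ => if_neg (by omega)
  rw [h1, Finset.mul_sum, ← Finset.sum_subset (Finset.range_mono (show n ≤ K by omega))]
  · refine Finset.sum_congr rfl fun i hi => ?_
    rw [Finset.mul_sum, ← Finset.sum_subset (Finset.range_mono (show n ≤ K by omega))]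
    · refine Finset.sum_congr rfl fun l hl => ?_
      rw [Finset.mem_range] at hi hl
      simp only [hF, if_pos hi, if_pos hl]
      split_ifs <;> simp
    · intro l _ hl
      rw [Finset.mem_range] at hl
      simp [hF, hl]
  · intro i _ hi
    rw [Finset.mem_range] at hi
    exact Finset.sum_eq_zero fun l _ => by simp [hF, hi]

end Tridiagonal

theorem hankelNonneg_of_midConvex {n : ℕ} {g : ℝ → ℝ} (hg : ContDiff ℝ (⊤ : ℕ∞) g) {J : Set ℝ}
    (hJ : IsOpen J) (h : MidConvex n g J) : HankelNonneg n g J := by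
  intro t ht c
  rcases n.eq_zero_or_pos with rfl | hn
  · simp
  set w : ℝ → Fin n → ℂ := testVec n c with hw
  have hwc : Continuous w := continuous_testVec c
  have h0 : (jacobiMatrix n).IsHermitian := jacobiMatrix_isHermitian
  have hp : (jacobiMatrix n + firstProj n).IsHermitian := h0.add firstProj_isHermitian
  have hm : (jacobiMatrix n - firstProj n).IsHermitian := h0.sub firstProj_isHermitian
  set G : ℕ → ℝ := fun k => iteratedDeriv k g t / k.factorial with hG
  set E : Matrix (Fin n) (Fin n) ℂ → ℝ → ℝ := fun M ε =>
    (qf g (fc (fun s => t + ε * s) M) (w ε) - ∑ k ∈ Finset.range (2 * n + 1), G k *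
      (star (w ε) ⬝ᵥ ((ε • M) ^ k *ᵥ w ε)).re) / ε ^ (2 * n) with hE
  have hE0 : ∀ M : Matrix (Fin n) (Fin n) ℂ, M.IsHermitian →
      Filter.Tendsto (E M) (nhdsWithin (0 : ℝ) (Set.Ioi 0)) (nhds 0) := fun M hM =>
    tendsto_qf_taylor hM hg t (2 * n) hwc
  set T : ℝ → ℝ := fun ε => ∑ k ∈ Finset.range (2 * n + 1), G k * ((momentDiff n c k ε).re / 2)
    with hT
  have hTlim : Filter.Tendsto T (nhdsWithin (0 : ℝ) (Set.Ioi 0)) (nhds (T 0)) := by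
    have : Continuous T := by
      refine continuous_finsetSum _ fun k _ => continuous_const.mul ?_
      exact (Complex.continuous_re.comp (continuous_momentDiff c k)).div_const 2
    exact this.continuousAt.tendsto.mono_left nhdsWithin_le_nhds
  have hT0 : T 0 = ∑ a ∈ Finset.range n, ∑ b ∈ Finset.range n, c a * c b * G (a + b + 2) := by
    have e1 : ∀ k, (momentDiff n c k 0).re / 2 = ∑ a ∈ Finset.range n, ∑ b ∈ Finset.range n,
        if a + b + 2 = k then c a * c b else 0 := by
      intro k
      rw [momentDiff_zero hn]
      have : (2 * ∑ i ∈ Finset.range n, ∑ l ∈ Finset.range n,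
          if i + l + 2 = k then (c i * c l : ℂ) else 0) = ((2 * ∑ i ∈ Finset.range n,
          ∑ l ∈ Finset.range n, if i + l + 2 = k then c i * c l else 0 : ℝ) : ℂ) := by
        push_cast
        congr 1
        refine Finset.sum_congr rfl fun a _ => Finset.sum_congr rfl fun b _ => ?_
        split_ifs <;> simp
      rw [this, Complex.ofReal_re]
      ring
    simp only [hT, e1, Finset.mul_sum]
    rw [Finset.sum_comm]
    refine Finset.sum_congr rfl fun a ha => ?_
    rw [Finset.sum_comm]
    refine Finset.sum_congr rfl fun b hb => ?_
    rw [Finset.mem_range] at ha hb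
    simp only [mul_ite, mul_zero]
    rw [Finset.sum_ite_eq, if_pos (Finset.mem_range.2 (by omega))]
    ring
  rw [← hT0]
  have hlim : Filter.Tendsto (fun ε => (E (jacobiMatrix n + firstProj n) ε +
      E (jacobiMatrix n - firstProj n) ε) / 2 - E (jacobiMatrix n) ε + T ε)
      (nhdsWithin (0 : ℝ) (Set.Ioi 0)) (nhds (T 0)) := by
    simpa using ((((hE0 _ hp).add (hE0 _ hm)).div_const 2).sub (hE0 _ h0)).add hTlim
  refine ge_of_tendsto hlim ?_
  filter_upwards [eventually_spectrum_subset h0 hJ ht, eventually_spectrum_subset hp hJ ht,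
    eventually_spectrum_subset hm hJ ht, self_mem_nhdsWithin] with ε s0 sp sm hε
  have hmid : (1 / 2 : ℝ) • (fc (fun s => t + ε * s) (jacobiMatrix n + firstProj n) +
      fc (fun s => t + ε * s) (jacobiMatrix n - firstProj n)) =
      fc (fun s => t + ε * s) (jacobiMatrix n) := by
    rw [fc_affine hp, fc_affine hm, fc_affine h0, smul_add, smul_sub]
    module
  have hconv := h _ _ (fc_isHermitian _ _) (fc_isHermitian _ _) sp sm (by rwa [hmid]) (w ε)
  rw [hmid] at hconv
  have hεpos : (0 : ℝ) < ε ^ (2 * n) := pow_pos hε _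
  have hmom : ∀ k, (star (w ε) ⬝ᵥ ((ε • (jacobiMatrix n + firstProj n)) ^ k *ᵥ w ε)).re +
      (star (w ε) ⬝ᵥ ((ε • (jacobiMatrix n - firstProj n)) ^ k *ᵥ w ε)).re =
      2 * (star (w ε) ⬝ᵥ ((ε • jacobiMatrix n) ^ k *ᵥ w ε)).re +
      ε ^ (2 * n) * (momentDiff n c k ε).re := by
    intro k
    have hsm : ∀ M : Matrix (Fin n) (Fin n) ℂ, ε • M = (ε : ℂ) • M := fun M => by
      ext i j
      simp
    have := congrArg Complex.re (moment_second_difference hn c k ε)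
    rw [Matrix.add_mulVec, dotProduct_add, Complex.add_re, Complex.add_re, ← Complex.ofReal_pow,
      Complex.re_ofReal_mul] at this
    rw [hw, star_testVec, hsm, hsm, hsm, smul_add, smul_sub, this]
    simp
  have key : (E (jacobiMatrix n + firstProj n) ε + E (jacobiMatrix n - firstProj n) ε) / 2 -
      E (jacobiMatrix n) ε + T ε = ((qf g (fc (fun s => t + ε * s) (jacobiMatrix n + firstProj n))
      (w ε) + qf g (fc (fun s => t + ε * s) (jacobiMatrix n - firstProj n)) (w ε)) / 2 -
      qf g (fc (fun s => t + ε * s) (jacobiMatrix n)) (w ε)) / ε ^ (2 * n) := by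
    have hTe : T ε * ε ^ (2 * n) = (∑ k ∈ Finset.range (2 * n + 1), G k *
        (star (w ε) ⬝ᵥ ((ε • (jacobiMatrix n + firstProj n)) ^ k *ᵥ w ε)).re +
        ∑ k ∈ Finset.range (2 * n + 1), G k *
        (star (w ε) ⬝ᵥ ((ε • (jacobiMatrix n - firstProj n)) ^ k *ᵥ w ε)).re) / 2 -
        ∑ k ∈ Finset.range (2 * n + 1), G k *
        (star (w ε) ⬝ᵥ ((ε • jacobiMatrix n) ^ k *ᵥ w ε)).re := by
      rw [← Finset.sum_add_distrib, Finset.sum_div, ← Finset.sum_sub_distrib, hT, Finset.sum_mul]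
      refine Finset.sum_congr rfl fun k _ => ?_
      linear_combination (-G k / 2) * hmom k
    rw [eq_div_iff hεpos.ne', add_mul, hTe]
    simp only [hE]
    field_simp
    ring
  rw [key]
  exact div_nonneg (by linarith) hεpos.le

theorem qf_congr {n : ℕ} {f g : ℝ → ℝ} {A : Matrix (Fin n) (Fin n) ℂ}
    (h : Set.EqOn f g (spectrum ℝ A)) (w : Fin n → ℂ) : qf f A w = qf g A w := by
  rw [qf, qf, fc_eq_cfc, fc_eq_cfc, cfc_congr h]

theorem MidConvex.congr {n : ℕ} {f g : ℝ → ℝ} {J K : Set ℝ} (h : MidConvex n f J) (hKJ : K ⊆ J)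
    (hfg : Set.EqOn f g K) : MidConvex n g K := by
  intro A B hA hB sA sB sC w
  rw [← qf_congr (hfg.mono sA), ← qf_congr (hfg.mono sB), ← qf_congr (hfg.mono sC)]
  exact h A B hA hB (sA.trans hKJ) (sB.trans hKJ) (sC.trans hKJ) w

theorem MidConvex.integral {n : ℕ} {f ψ g : ℝ → ℝ} {J K : Set ℝ} (hf : MidConvex n f K)
    (hψ : ∀ s, 0 ≤ ψ s) (τ : ℝ) (hK : ∀ t ∈ J, ∀ s, ψ s ≠ 0 → t + τ - s ∈ K)
    (hintegrable : ∀ t ∈ J, MeasureTheory.Integrable fun s => ψ s * f (t + τ - s))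
    (hg : ∀ t ∈ J, g t = ∫ s, ψ s * f (t + τ - s)) : MidConvex n g J := by
  set sh : ℝ → ℝ → ℝ := fun s u => (τ - s) + 1 * u with hsh
  have hshift : ∀ s u, f (sh s u) = f (u + τ - s) := fun s u => by
    rw [hsh]; congr 1; ring
  have key : ∀ C : Matrix (Fin n) (Fin n) ℂ, C.IsHermitian → spectrum ℝ C ⊆ J → ∀ w,
      MeasureTheory.Integrable (fun s => ψ s * qf f (fc (sh s) C) w) ∧
      qf g C w = ∫ s, ψ s * qf f (fc (sh s) C) w := by
    intro C hC sC w
    have hmem : ∀ i, hC.eigenvalues i ∈ J := fun i => sC (hC.eigenvalues_mem_spectrum_real i)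
    have e : (fun s => ψ s * qf f (fc (sh s) C) w) = fun s => ∑ i,
        ψ s * f (hC.eigenvalues i + τ - s) * spectralWeight hC w i := by
      funext s
      rw [qf_comp hC, qf_eq_sum _ hC, Finset.mul_sum]
      refine Finset.sum_congr rfl fun i _ => ?_
      rw [hshift, mul_assoc]
    have hi : ∀ i ∈ Finset.univ, MeasureTheory.Integrable fun s =>
        ψ s * f (hC.eigenvalues i + τ - s) * spectralWeight hC w i := fun i _ =>
      (hintegrable _ (hmem i)).mul_const _
    rw [e]
    refine ⟨MeasureTheory.integrable_finsetSum _ hi, ?_⟩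
    rw [MeasureTheory.integral_finsetSum _ hi, qf_eq_sum _ hC]
    refine Finset.sum_congr rfl fun i _ => ?_
    rw [MeasureTheory.integral_mul_const, hg _ (hmem i)]
  intro A B hA hB sA sB sC w
  have hC : ((1 / 2 : ℝ) • (A + B)).IsHermitian :=
    (hA.add hB).smul (by simp [IsSelfAdjoint])
  obtain ⟨iA, eA⟩ := key A hA sA w
  obtain ⟨iB, eB⟩ := key B hB sB w
  obtain ⟨iC, eC⟩ := key _ hC sC w
  rw [eA, eB, eC, ← MeasureTheory.integral_add iA iB, ← MeasureTheory.integral_div]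
  refine MeasureTheory.integral_mono iC ((iA.add iB).div_const 2) fun s => ?_
  by_cases hs : ψ s = 0
  · simp [hs]
  have hsub : ∀ C : Matrix (Fin n) (Fin n) ℂ, C.IsHermitian → spectrum ℝ C ⊆ J →
      spectrum ℝ (fc (sh s) C) ⊆ K := by
    intro C hC sC
    rw [spectrum_fc hC]
    rintro _ ⟨u, hu, rfl⟩
    have : sh s u = u + τ - s := by rw [hsh]; ring
    rw [this]
    exact hK u (sC hu) s hs
  have hmid : (1 / 2 : ℝ) • (fc (sh s) A + fc (sh s) B) = fc (sh s) ((1 / 2 : ℝ) • (A + B)) := by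
    rw [hsh, fc_affine hA, fc_affine hB, fc_affine hC]
    module
  have := hf _ _ (fc_isHermitian (sh s) A) (fc_isHermitian (sh s) B) (hsub A hA sA)
    (hsub B hB sB) (by rw [hmid]; exact hsub _ hC sC) w
  rw [hmid] at this
  have h2 := mul_le_mul_of_nonneg_left this (hψ s)
  simp only
  linarith

/-- Shifted mollification of a matrix convex function on the open unit interval. -/
theorem exists_mollification {n : ℕ} {f : ℝ → ℝ} (hmid : MidConvex n f (Set.Ioo 0 1))
    (hcont : ContinuousOn f (Set.Ioo 0 1)) {δ : ℝ} (hδ : 0 < δ) :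
    ∃ g : ℝ → ℝ, ContDiff ℝ (⊤ : ℕ∞) g ∧ MidConvex n g (Set.Ioo (-δ) (1 - 5 * δ)) ∧
      ∀ t ∈ Set.Ioo (-δ) (1 - 5 * δ),
        (∀ b, (∀ x, |x - (t + 3 * δ)| < δ → f x ≤ b) → g t ≤ b) ∧
        (∀ b, (∀ x, |x - (t + 3 * δ)| < δ → b ≤ f x) → b ≤ g t) := by
  set K := Set.Icc δ (1 - δ)
  have hKsub : K ⊆ Set.Ioo 0 1 := fun x hx => ⟨hδ.trans_le hx.1, by linarith [hx.2]⟩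
  set F : ℝ → ℝ := K.indicator f with hF
  have hFK : Set.EqOn f F K := fun x hx => (Set.indicator_of_mem hx f).symm
  have hFint : MeasureTheory.LocallyIntegrable F := by
    refine MeasureTheory.Integrable.locallyIntegrable ?_
    rw [hF, MeasureTheory.integrable_indicator_iff measurableSet_Icc]
    exact (hcont.mono hKsub).integrableOn_compact isCompact_Icc
  let φ : ContDiffBump (0 : ℝ) := ⟨δ / 2, δ, by positivity, by linarith⟩
  set ψ : ℝ → ℝ := φ.normed MeasureTheory.volume with hψ
  have hψs : ∀ s, ψ s ≠ 0 → |s| < δ := fun s hs => by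
    have : s ∈ Function.support ψ := hs
    rw [hψ, φ.support_normed_eq] at this
    simpa using this
  have hψ0 : ∀ s, 0 ≤ ψ s := fun s => φ.nonneg_normed s
  have hmem : ∀ t ∈ Set.Ioo (-δ) (1 - 5 * δ), ∀ s, ψ s ≠ 0 → t + 3 * δ - s ∈ K := by
    intro t ht s hs
    have := abs_lt.1 (hψs s hs)
    exact ⟨by linarith [ht.1], by linarith [ht.2]⟩
  have hintegrable : ∀ x, MeasureTheory.Integrable fun s => ψ s * F (x - s) := fun x =>
    φ.hasCompactSupport_normed.convolutionExists_left (ContinuousLinearMap.lsmul ℝ ℝ)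
      φ.continuous_normed hFint x
  set G : ℝ → ℝ :=
    MeasureTheory.convolution ψ F (ContinuousLinearMap.lsmul ℝ ℝ) MeasureTheory.volume
    with hG
  have hGs : ContDiff ℝ (⊤ : ℕ∞) G :=
    φ.hasCompactSupport_normed.contDiff_convolution_left _ φ.contDiff_normed hFint
  have hGeq : ∀ t, G (t + 3 * δ) = ∫ s, ψ s * F (t + 3 * δ - s) := fun t => rfl
  have hone : ∀ b : ℝ, ∫ s, ψ s * b = b := fun b => φ.integral_normed_smul MeasureTheory.volume b
  have hψi : ∀ b : ℝ, MeasureTheory.Integrable fun s => ψ s * b := fun b =>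
    φ.integrable_normed.mul_const b
  refine ⟨fun t => G (t + 3 * δ), hGs.comp (contDiff_id.add contDiff_const),
    (hmid.congr hKsub hFK).integral hψ0 (3 * δ) hmem (fun t _ => hintegrable _) (fun t _ => hGeq t),
    fun t ht => ⟨fun b hb => ?_, fun b hb => ?_⟩⟩
  · refine (MeasureTheory.integral_mono (hintegrable _) (hψi b) fun s => ?_).trans_eq (hone b)
    by_cases hs : ψ s = 0
    · simp [hs]
    · refine mul_le_mul_of_nonneg_left ?_ (hψ0 s)
      rw [← hFK (hmem t ht s hs)]
      exact hb _ (by simpa using hψs s hs)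
  · refine (hone b).symm.trans_le (MeasureTheory.integral_mono (hψi b) (hintegrable _) fun s => ?_)
    by_cases hs : ψ s = 0
    · simp [hs]
    · refine mul_le_mul_of_nonneg_left ?_ (hψ0 s)
      rw [← hFK (hmem t ht s hs)]
      exact hb _ (by simpa using hψs s hs)

/-- Positivity of the Jensen kernel of `g` at any `n` nodes in `J`, for some choice of the divided
difference. -/
def KernelPos (n : ℕ) (g : ℝ → ℝ) (J : Set ℝ) : Prop :=
  ∃ d : ℝ → ℝ → ℝ, ∀ l : Fin n → ℝ, (∀ a, l a ∈ J) → ∀ z ∈ J, (Matrix.of fun a b =>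
    ((g z - g (l a) - (z - l a) * d (l a) (l b) : ℝ) : ℂ)).PosSemidef

theorem KernelPos.mono {n : ℕ} {g : ℝ → ℝ} {J K : Set ℝ} (h : KernelPos n g J) (hKJ : K ⊆ J) :
    KernelPos n g K :=
  let ⟨d, hd⟩ := h
  ⟨d, fun l hl z hz => hd l (fun a => hKJ (hl a)) z (hKJ hz)⟩

theorem KernelPos.add {n : ℕ} {g h : ℝ → ℝ} {J : Set ℝ} (hg : KernelPos n g J)
    (hh : KernelPos n h J) : KernelPos n (fun t => g t + h t) J := by
  obtain ⟨d, hd⟩ := hg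
  obtain ⟨e, he⟩ := hh
  refine ⟨fun x y => d x y + e x y, fun l hl z hz => ?_⟩
  convert (hd l hl z hz).add (he l hl z hz) using 1
  ext a b
  simp only [Matrix.of_apply, Matrix.add_apply]
  push_cast
  ring

theorem MidConvex.kernelPos {n : ℕ} {g : ℝ → ℝ} (hg : ContDiff ℝ (⊤ : ℕ∞) g) {J : Set ℝ}
    (hJ : IsOpen J) (hJ' : J.OrdConnected) (h : MidConvex n g J) : KernelPos n g J :=
  ⟨dslope g, fun _ hl _ hz =>
    kernel_posSemidef hg hJ' (hankelNonneg_of_midConvex hg hJ h) hl hz⟩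

theorem kernelPos_resolvent (n : ℕ) {c s : ℝ} (hc : 0 ≤ c) (hs : 0 ≤ s) :
    KernelPos n (fun t => c / (1 + s * t)) (Set.Ici 0) := by
  refine ⟨fun x y => -(c * s) / ((1 + s * x) * (1 + s * y)), fun l hl z hz => ?_⟩
  have hpos : ∀ x ∈ Set.Ici (0 : ℝ), 0 < 1 + s * x := fun x hx =>
    add_pos_of_pos_of_nonneg one_pos (mul_nonneg hs hx)
  have hK : ∀ a b, c / (1 + s * z) - c / (1 + s * l a) -
      (z - l a) * (-(c * s) / ((1 + s * l a) * (1 + s * l b))) =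
      c * s ^ 2 / (1 + s * z) * (((z - l a) / (1 + s * l a)) * ((z - l b) / (1 + s * l b))) := by
    intro a b
    have h1 := (hpos z hz).ne'
    have h2 := (hpos _ (hl a)).ne'
    have h3 := (hpos _ (hl b)).ne'
    field_simp
    ring
  refine posSemidef_of_real _ (fun a b => ?_) fun w => ?_
  · rw [hK, hK]; ring
  · have : ∑ a, ∑ b, w a * w b * (c / (1 + s * z) - c / (1 + s * l a) -
        (z - l a) * (-(c * s) / ((1 + s * l a) * (1 + s * l b)))) =
        c * s ^ 2 / (1 + s * z) * ((∑ a, w a * ((z - l a) / (1 + s * l a))) *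
          ∑ a, w a * ((z - l a) / (1 + s * l a))) := by
      rw [Finset.sum_mul_sum, Finset.mul_sum]
      refine Finset.sum_congr rfl fun a _ => ?_
      rw [Finset.mul_sum]
      refine Finset.sum_congr rfl fun b _ => ?_
      rw [hK]; ring
    rw [this]
    exact mul_nonneg (div_nonneg (by positivity) (hpos z hz).le) (mul_self_nonneg _)

theorem exists_kernelPos_approx {n : ℕ} {f : ℝ → ℝ} (hmid : MidConvex n f (Set.Ioo 0 1))
    (hf : ConvexOn ℝ (Set.Ico 0 1) f) {δ : ℝ} (hδ : 0 < δ) (hδ' : δ < 1 / 8) :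
    ∃ g : ℝ → ℝ, KernelPos n g (Set.Ico 0 (1 - 5 * δ)) ∧
      g 0 = f 0 + 8 * δ * |f (1 / 2) - f 0| ∧
      ∀ t ∈ Set.Ioo 0 (1 - 5 * δ),
        (∀ b, (∀ x, |x - (t + 3 * δ)| < δ → f x ≤ b) → g t ≤ b + δ / t) ∧
        (∀ b, (∀ x, |x - (t + 3 * δ)| < δ → b ≤ f x) → b ≤ g t) := by
  have hcont : ContinuousOn f (Set.Ioo 0 1) :=
    (hf.subset Set.Ioo_subset_Ico_self (convex_Ioo 0 1)).continuousOn isOpen_Ioo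
  obtain ⟨g, hgs, hgm, hgb⟩ := exists_mollification hmid hcont hδ
  set B := |f (1 / 2) - f 0| with hB
  have hg0 : g 0 ≤ f 0 + 8 * δ * B := by
    refine (hgb 0 ⟨by linarith, by linarith⟩).1 _ fun x hx => ?_
    rw [abs_lt] at hx
    have h1 : f ((1 - 2 * x) * 0 + 2 * x * (1 / 2)) ≤ (1 - 2 * x) * f 0 + 2 * x * f (1 / 2) :=
      hf.2 ⟨le_rfl, one_pos⟩ ⟨by norm_num, by norm_num⟩ (by linarith) (by linarith) (by ring)
    have h2 : (1 - 2 * x) * 0 + 2 * x * (1 / 2) = x := by ring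
    rw [h2] at h1
    have h3 : f (1 / 2) - f 0 ≤ B := le_abs_self _
    have h4 : 0 ≤ B := abs_nonneg _
    nlinarith
  set c := f 0 + 8 * δ * B - g 0 with hc
  have hc0 : 0 ≤ c := by linarith
  set s := (1 + c) / δ with hs
  have hs0 : 0 < s := by positivity
  refine ⟨fun t => g t + c / (1 + s * t), ?_, ?_, fun t ht => ⟨fun b hb => ?_, fun b hb => ?_⟩⟩
  · refine ((hgm.kernelPos hgs isOpen_Ioo Set.ordConnected_Ioo).mono ?_).add
      ((kernelPos_resolvent n hc0 hs0.le).mono Set.Ico_subset_Ici_self)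
    exact fun x hx => ⟨by linarith [hx.1], hx.2⟩
  · simp [hc]
  · refine add_le_add ((hgb t ⟨by linarith [ht.1], ht.2⟩).1 b hb) ?_
    have ht0 := ht.1
    rw [div_le_div_iff₀ (by positivity) ht0]
    have : δ * (1 + s * t) = δ + (1 + c) * t := by rw [hs]; field_simp
    rw [this]
    nlinarith
  · have h1 := (hgb t ⟨by linarith [ht.1], ht.2⟩).2 b hb
    have h2 : 0 ≤ c / (1 + s * t) := by
      have ht0 := ht.1
      positivity
    linarith

theorem exists_kernelPos_seq {n : ℕ} {f : ℝ → ℝ} (hmid : MidConvex n f (Set.Ioo 0 1))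
    (hf : ConvexOn ℝ (Set.Ico 0 1) f) :
    ∃ G : ℕ → ℝ → ℝ, (∀ r < 1, ∀ᶠ m in Filter.atTop, KernelPos n (G m) (Set.Icc 0 r)) ∧
      ∀ t ∈ Set.Ico (0 : ℝ) 1, Filter.Tendsto (fun m => G m t) Filter.atTop (nhds (f t)) := by
  have hcont : ContinuousOn f (Set.Ioo 0 1) :=
    (hf.subset Set.Ioo_subset_Ico_self (convex_Ioo 0 1)).continuousOn isOpen_Ioo
  set δ : ℕ → ℝ := fun m => 1 / ((m : ℝ) + 1) / 9 with hδ
  have hδlim : Filter.Tendsto δ Filter.atTop (nhds 0) := by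
    have := (tendsto_one_div_add_atTop_nhds_zero_nat (𝕜 := ℝ)).div_const 9
    rwa [zero_div] at this
  have hδ0 : ∀ m, 0 < δ m := fun m => by positivity
  have hδ1 : ∀ m, δ m < 1 / 8 := fun m => by
    have : 1 / ((m : ℝ) + 1) ≤ 1 := by
      rw [div_le_one (by positivity)]
      linarith [(Nat.cast_nonneg m : (0 : ℝ) ≤ m)]
    simp only [hδ]
    linarith
  choose G hG1 hG2 hG3 using fun m => exists_kernelPos_approx hmid hf (hδ0 m) (hδ1 m)
  have hr : ∀ r < (1 : ℝ), ∀ᶠ m in Filter.atTop, r < 1 - 5 * δ m := by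
    intro r hr
    have : Filter.Tendsto (fun m => 1 - 5 * δ m) Filter.atTop (nhds (1 - 5 * 0)) :=
      tendsto_const_nhds.sub (hδlim.const_mul 5)
    exact this.eventually_const_lt (by linarith)
  refine ⟨G, fun r hr1 => ?_, fun t ht => ?_⟩
  · filter_upwards [hr r hr1] with m hm
    exact (hG1 m).mono fun x hx => ⟨hx.1, hx.2.trans_lt hm⟩
  · rcases ht.1.eq_or_lt with rfl | ht0
    · simp only [hG2]
      have := ((hδlim.const_mul 8).mul_const |f (1 / 2) - f 0|).const_add (f 0)
      simpa using this
    · rw [Metric.tendsto_atTop']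
      intro ε hε
      obtain ⟨η, hη, hfη⟩ := Metric.continuousAt_iff.1
        (hcont.continuousAt (isOpen_Ioo.mem_nhds ⟨ht0, ht.2⟩)) (ε / 2) (by positivity)
      have h1 : ∀ᶠ m in Filter.atTop, 4 * δ m < η := by
        have := hδlim.const_mul 4
        exact this.eventually_lt_const (by simpa using hη)
      have h2 : ∀ᶠ m in Filter.atTop, δ m / t < ε / 2 := by
        have := hδlim.div_const t
        exact this.eventually_lt_const (by simpa using hε)
      obtain ⟨N, hN⟩ := Filter.eventually_atTop.1 ((hr t ht.2).and (h1.and h2))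
      refine ⟨N, fun m hm => ?_⟩
      obtain ⟨a1, a2, a3⟩ := hN m hm.le
      have hclose : ∀ x, |x - (t + 3 * δ m)| < δ m → |f x - f t| < ε / 2 := by
        intro x hx
        refine hfη ?_
        rw [Real.dist_eq, abs_lt]
        rw [abs_lt] at hx
        have := hδ0 m
        constructor <;> linarith
      have b1 := (hG3 m t ⟨ht0, a1⟩).1 (f t + ε / 2) fun x hx => by
        linarith [(abs_lt.1 (hclose x hx)).2]
      have b2 := (hG3 m t ⟨ht0, a1⟩).2 (f t - ε / 2) fun x hx => by
        linarith [(abs_lt.1 (hclose x hx)).1]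
      rw [Real.dist_eq, abs_lt]
      constructor <;> linarith

theorem eigenvalues_mem_Icc_of_eq_sum {n : ℕ} {ι : Type*} [Fintype ι]
    {X : Matrix (Fin n) (Fin n) ℂ} (hX : X.IsHermitian) (A : ι → Matrix (Fin n) (Fin n) ℂ)
    (hA : ∀ k, (A k).PosSemidef) (hA1 : ∑ k, A k = 1) (t : ι → ℝ)
    (hXA : X = ∑ k, (t k : ℂ) • A k) {p q : ℝ} (ht : ∀ k, t k ∈ Set.Icc p q) (i : Fin n) :
    hX.eigenvalues i ∈ Set.Icc p q := by
  set U : Matrix (Fin n) (Fin n) ℂ := (hX.eigenvectorUnitary : Matrix (Fin n) (Fin n) ℂ) with hU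
  have hUU : Uᴴ * U = 1 := Unitary.coe_star_mul_self hX.eigenvectorUnitary
  have hdiag := conj_fc id hX
  have hfid : fc id X = X := by rw [fc_eq_cfc]; exact cfc_id ℝ X hX
  rw [hfid] at hdiag
  have h1 : ∑ k, Uᴴ * A k * U = 1 := by
    rw [← Finset.sum_mul, ← Finset.mul_sum, hA1, Matrix.mul_one, hUU]
  have h2 : ∑ k, (t k : ℂ) • (Uᴴ * A k * U) =
      Matrix.diagonal (fun i => (hX.eigenvalues i : ℂ)) := by
    calc _ = Uᴴ * (∑ k, (t k : ℂ) • A k) * U := by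
          rw [Finset.mul_sum, Finset.sum_mul]
          simp
      _ = _ := by rw [← hXA]; exact hdiag
  have hw : ∀ k, 0 ≤ ((Uᴴ * A k * U) i i).re := fun k =>
    (Complex.nonneg_iff.1 ((hA k).conjTranspose_mul_mul_same U).diag_nonneg).1
  have e1 := congrArg Complex.re (congrFun (congrFun h1 i) i)
  have e2 := congrArg Complex.re (congrFun (congrFun h2 i) i)
  simp only [Matrix.sum_apply, Matrix.smul_apply, smul_eq_mul, Matrix.one_apply_eq,
    Matrix.diagonal_apply_eq, Complex.re_sum, Complex.re_ofReal_mul, Complex.ofReal_re,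
    Complex.one_re] at e1 e2
  rw [← e2]
  constructor
  · calc p = ∑ k, p * ((Uᴴ * A k * U) i i).re := by rw [← Finset.mul_sum, e1, mul_one]
      _ ≤ _ := Finset.sum_le_sum fun k _ => mul_le_mul_of_nonneg_right (ht k).1 (hw k)
  · calc _ ≤ ∑ k, q * ((Uᴴ * A k * U) i i).re :=
          Finset.sum_le_sum fun k _ => mul_le_mul_of_nonneg_right (ht k).2 (hw k)
      _ = q := by rw [← Finset.mul_sum, e1, mul_one]

/-- Operator convexity of `f` on `[0, 1)` for matrices of size `n`. -/
def OpConvex (n : ℕ) (f : ℝ → ℝ) : Prop :=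
  ∀ (a b : Matrix (Fin n) (Fin n) ℂ) (ha : a.IsHermitian) (hb : b.IsHermitian),
    (∀ j, ha.eigenvalues j ∈ Set.Ico (0 : ℝ) 1) → (∀ j, hb.eigenvalues j ∈ Set.Ico (0 : ℝ) 1) →
    ∀ lam ∈ Set.Icc (0 : ℝ) 1,
      Loewner (fc f (lam • a + (1 - lam) • b)) (lam • fc f a + (1 - lam) • fc f b)

theorem OpConvex.midConvex {n : ℕ} {f : ℝ → ℝ} (h : OpConvex n f) :
    MidConvex n f (Set.Ioo 0 1) := by
  intro A B hA hB hsA hsB _ w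
  have h1 := h A B hA hB
    (fun j => Set.Ioo_subset_Ico_self (hsA (hA.eigenvalues_mem_spectrum_real j)))
    (fun j => Set.Ioo_subset_Ico_self (hsB (hB.eigenvalues_mem_spectrum_real j)))
    (1 / 2) ⟨by norm_num, by norm_num⟩
  have h2 : (1 / 2 : ℝ) • A + (1 - 1 / 2 : ℝ) • B = (1 / 2 : ℝ) • (A + B) := by
    rw [smul_add]; norm_num
  rw [h2] at h1
  have h3 := qf_le_of_loewner h1 w
  rw [Matrix.add_mulVec, Matrix.smul_mulVec, Matrix.smul_mulVec, dotProduct_add,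
    dotProduct_smul, dotProduct_smul, Complex.add_re, Complex.smul_re, Complex.smul_re] at h3
  simp only [smul_eq_mul] at h3
  simp only [qf] at h3 ⊢
  linarith

theorem fc_algebraMap {n : ℕ} (f : ℝ → ℝ) (x : ℝ) :
    fc f (algebraMap ℝ (Matrix (Fin n) (Fin n) ℂ) x) = algebraMap ℝ _ (f x) :=
  (fc_eq_cfc f _).trans (cfc_algebraMap x f)

theorem OpConvex.convexOn {n : ℕ} (hn : 0 < n) {f : ℝ → ℝ} (h : OpConvex n f) :
    ConvexOn ℝ (Set.Ico 0 1) f := by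
  have : Nonempty (Fin n) := ⟨⟨0, hn⟩⟩
  refine ⟨convex_Ico 0 1, fun x hx y hy a b ha hb hab => ?_⟩
  have hherm : ∀ z : ℝ, (algebraMap ℝ (Matrix (Fin n) (Fin n) ℂ) z).IsHermitian := fun z =>
    IsSelfAdjoint.algebraMap _ (IsSelfAdjoint.all z)
  have hspec : ∀ z ∈ Set.Ico (0 : ℝ) 1, ∀ j, (hherm z).eigenvalues j ∈ Set.Ico (0 : ℝ) 1 := by
    intro z hz j
    have := (hherm z).eigenvalues_mem_spectrum_real j
    rw [spectrum.scalar_eq] at this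
    rwa [Set.mem_singleton_iff.1 this]
  have h1 := h _ _ (hherm x) (hherm y) (hspec x hx) (hspec y hy) a ⟨ha, by linarith⟩
  have hb' : 1 - a = b := by linarith
  have hsmul : ∀ c z : ℝ, c • algebraMap ℝ (Matrix (Fin n) (Fin n) ℂ) z = algebraMap ℝ _ (c * z) :=
    fun c z => by rw [map_mul, Algebra.smul_def]
  rw [hb', fc_algebraMap, fc_algebraMap, hsmul, hsmul, hsmul, hsmul, ← map_add, ← map_add,
    fc_algebraMap, Loewner, ← map_sub] at h1
  have h2 := h1.diag_nonneg (i := ⟨0, hn⟩)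
  rw [Matrix.algebraMap_matrix_apply, if_pos rfl] at h2
  exact sub_nonneg.1 (Complex.zero_le_real.1 h2)

theorem fc_eq_sum {n : ℕ} (f : ℝ → ℝ) {A : Matrix (Fin n) (Fin n) ℂ} (h : A.IsHermitian) :
    fc f A = ∑ j, (f (h.eigenvalues j) : ℂ) •
      ((h.eigenvectorUnitary : Matrix (Fin n) (Fin n) ℂ) * Matrix.diagonal (Pi.single j 1) *
        (h.eigenvectorUnitary : Matrix (Fin n) (Fin n) ℂ)ᴴ) := by
  have h1 : Matrix.diagonal (fun i => (f (h.eigenvalues i) : ℂ)) =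
      ∑ j, (f (h.eigenvalues j) : ℂ) • Matrix.diagonal (Pi.single j (1 : ℂ)) := by
    ext a b
    rw [Matrix.sum_apply]
    by_cases hab : a = b
    · subst hab
      simp [Pi.single_apply]
    · simp [hab]
  rw [fc, dif_pos h, h1, Finset.mul_sum, Finset.sum_mul]
  simp only [Matrix.mul_smul, Matrix.smul_mul]
  rfl

theorem OpConvex.jensen {n : ℕ} {f : ℝ → ℝ} (h : OpConvex n f) {ι : Type*} [Fintype ι]
    (A : ι → Matrix (Fin n) (Fin n) ℂ) (hA : ∀ k, (A k).PosSemidef) (hA1 : ∑ k, A k = 1)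
    (t : ι → ℝ) (ht : ∀ k, t k ∈ Set.Ico (0 : ℝ) 1) :
    Loewner (fc f (∑ k, (t k : ℂ) • A k)) (∑ k, (f (t k) : ℂ) • A k) := by
  rcases n.eq_zero_or_pos with rfl | hn
  · rw [Loewner, Subsingleton.elim (_ - _) (0 : Matrix (Fin 0) (Fin 0) ℂ)]
    exact Matrix.PosSemidef.zero
  obtain ⟨r, hr0, hr1, htr⟩ : ∃ r : ℝ, 0 ≤ r ∧ r < 1 ∧ ∀ k, t k ≤ r := by
    refine ⟨(Finset.univ.sup fun k => (t k).toNNReal : NNReal), NNReal.coe_nonneg _, ?_, ?_⟩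
    · rw [← NNReal.coe_one, NNReal.coe_lt_coe, Finset.sup_lt_iff (by simp)]
      exact fun k _ => Real.toNNReal_lt_one.2 (ht k).2
    · intro k
      exact (Real.le_coe_toNNReal _).trans (NNReal.coe_le_coe.2
        (Finset.le_sup (f := fun k => (t k).toNNReal) (Finset.mem_univ k)))
  have hX : (∑ k, (t k : ℂ) • A k).IsHermitian :=
    isSelfAdjoint_sum _ fun k _ => (hA k).isHermitian.smul (by simp [IsSelfAdjoint])
  have ht' : ∀ k, t k ∈ Set.Icc 0 r := fun k => ⟨(ht k).1, htr k⟩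
  have hev := eigenvalues_mem_Icc_of_eq_sum hX A hA hA1 t rfl ht'
  obtain ⟨G, hG, hGf⟩ := exists_kernelPos_seq h.midConvex (h.convexOn hn)
  refine loewner_jensen_of_tendsto f G hX A hA t ?_
    (fun a => hGf _ ⟨(hev a).1, (hev a).2.trans_lt hr1⟩) fun k => hGf _ (ht k)
  filter_upwards [hG r hr1] with m ⟨d, hd⟩
  exact loewner_jensen_of_kernel (G m) d hX A hA hA1 t rfl fun k => hd _ hev _ (ht' k)

theorem stmt_14 {n N : ℕ} (f : ℝ → ℝ)
    (hconv : ∀ (a b : Matrix (Fin n) (Fin n) ℂ) (ha : a.IsHermitian)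
      (hb : b.IsHermitian), (∀ j, ha.eigenvalues j ∈ Set.Ico (0 : ℝ) 1) →
      (∀ j, hb.eigenvalues j ∈ Set.Ico (0 : ℝ) 1) →
      ∀ lam ∈ Set.Icc (0 : ℝ) 1,
        Loewner (fc f (lam • a + (1 - lam) • b))
          (lam • fc f a + (1 - lam) • fc f b))
    (φ : Fin N → (Matrix (Fin n) (Fin n) ℂ →ₗ[ℂ] Matrix (Fin n) (Fin n) ℂ))
    (hφ : ∀ i A, A.PosSemidef → (φ i A).PosSemidef)
    (hunital : ∑ i, φ i 1 = 1)
    (x : Fin N → Matrix (Fin n) (Fin n) ℂ) (hx : ∀ i, (x i).IsHermitian)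
    (hspec : ∀ i j, (hx i).eigenvalues j ∈ Set.Ico (0 : ℝ) 1) :
    Loewner (fc f (∑ i, φ i (x i))) (∑ i, φ i (fc f (x i))) := by
  set P : Fin N → Fin n → Matrix (Fin n) (Fin n) ℂ := fun i j =>
    ((hx i).eigenvectorUnitary : Matrix (Fin n) (Fin n) ℂ) * Matrix.diagonal (Pi.single j 1) *
      ((hx i).eigenvectorUnitary : Matrix (Fin n) (Fin n) ℂ)ᴴ with hP
  have hPpos : ∀ i j, (P i j).PosSemidef := fun i j =>
    (Matrix.PosSemidef.diagonal (Pi.single_nonneg.2 zero_le_one)).mul_mul_conjTranspose_same _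
  have hfcx : ∀ (g : ℝ → ℝ) i, φ i (fc g (x i)) =
      ∑ j, (g ((hx i).eigenvalues j) : ℂ) • φ i (P i j) := fun g i => by
    rw [fc_eq_sum g (hx i), map_sum]
    simp only [map_smul, hP]
  have hid : ∀ i, φ i (x i) = ∑ j, ((hx i).eigenvalues j : ℂ) • φ i (P i j) := fun i => by
    have hfid : fc id (x i) = x i := (fc_eq_cfc id _).trans (cfc_id ℝ (x i) (hx i))
    have := hfcx id i
    rwa [hfid] at this
  have hone : ∀ i, φ i 1 = ∑ j, φ i (P i j) := fun i => by
    have hf1 : fc (fun _ => 1) (x i) = 1 :=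
      (fc_eq_cfc _ _).trans (cfc_const_one ℝ (x i) (hx i))
    have := hfcx (fun _ => 1) i
    rw [hf1] at this
    simpa using this
  simp only [hid, hfcx]
  have := OpConvex.jensen hconv (fun k : Fin N × Fin n => φ k.1 (P k.1 k.2))
    (fun k => hφ _ _ (hPpos _ _))
    (by rw [Fintype.sum_prod_type, ← hunital]; exact Finset.sum_congr rfl fun i _ => (hone i).symm)
    (fun k => (hx k.1).eigenvalues k.2) fun k => hspec _ _
  simpa only [Fintype.sum_prod_type] using this
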